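/- arXiv:2501.06387 — 2 statements merged into one kernel-verified Lean document; each statement's English description precedes it below -/
import Mathlib

section
/- (Paraproduct decompositions for a fifth power.) Fix d ≥ 1. There exists a constant C ≥ 1 (depending only on d and the Littlewood–Paley bump φ) such that for every Schwartz function f on ℝ^d, every dyadic N ∈ 2^ℤ, and every x ∈ ℝ^d: (i) |P_N(f⁵)(x)| ≤ C Σ M[f_{N₁} f_{N₂} f_{N₃} f_{N₄} f_{N₅}](x) + C Σ' M[f_{N₁} f_{N₂} f_{N₃} f_{N₄} f_{N₅}](x), where Σ runs over dyadic tuples N₅ ≤ N₄ ≤ N₃ ≤ N₂ ≤ N₁ with N₂ ≥ N₁/C and N₁ ≥ N/C, and Σ' runs over dyadic tuples N₅ ≤ N₄ ≤ N₃ ≤ N₂ ≤ N₁ with N/C ≤ N₁ ≤ C·N; and consequently (ii) |P_N(f⁵)(x)| ≤ 2C Σ'' M[f_{N₁} f_{N₂} f_{N₃} f_{N₄} f_{N₅}](x), where Σ'' runs over dyadic tuples N₅ ≤ N₄ ≤ N₃ ≤ N₂ ≤ N₁ with N₁ ≥ N/C. Here M denotes the Hardy–Littlewood maximal function and f_{N_i}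 = P_{N_i} f. -/
open MeasureTheory SchwartzMap Metric Set
open scoped ENNReal NNReal FourierTransform RealInnerProductSpace

noncomputable section

abbrev Ed (d : ℕ) := EuclideanSpace ℝ (Fin d)

/-- Fourier multiplier with symbol `m` on `ℝ^d`. -/
def fmulD (d : ℕ) (m : Ed d → ℂ) (f : Ed d → ℂ) : Ed d → ℂ :=
  𝓕⁻ (fun ξ => m ξ * 𝓕 f ξ)

/-- The fractional derivative `|∇|^s` on `ℝ^d`. -/
def absGradD (d : ℕ) (s : ℝ) (f : Ed d → ℂ) : Ed d → ℂ :=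
  fmulD d (fun ξ => (((2 * Real.pi * ‖ξ‖) ^ s : ℝ) : ℂ)) f

/-- The half-wave propagator `e^{σ i t |∇|}` on `ℝ^d`. -/
def halfWaveD (d : ℕ) (σ t : ℝ) (f : Ed d → ℂ) : Ed d → ℂ :=
  fmulD d (fun ξ => Complex.exp (Complex.I * (σ * (2 * Real.pi * t * ‖ξ‖)))) f

/-- A Littlewood–Paley bump function on `ℝ^d`. -/
structure IsLPBumpD (d : ℕ) (φ : Ed d → ℝ) : Prop where
  smooth : ContDiff ℝ (⊤ : ℕ∞) φ
  mem_Icc : ∀ ξ, φ ξ ∈ Icc (0:ℝ) 1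
  eq_one : ∀ ξ : Ed d, ‖ξ‖ ≤ 1 → φ ξ = 1
  eq_zero : ∀ ξ : Ed d, 2 ≤ ‖ξ‖ → φ ξ = 0

/-- The Littlewood–Paley projection `P_N` on `ℝ^d`. -/
def LPD (d : ℕ) (φ : Ed d → ℝ) (N : ℝ) (f : Ed d → ℂ) : Ed d → ℂ :=
  fmulD d (fun ξ => ((φ (N⁻¹ • ξ) - φ ((2 / N) • ξ) : ℝ) : ℂ)) f

/-- The homogeneous Besov norm `Ḃ^s_{p,1}` on `ℝ^d`. -/
def besovD (d : ℕ) (φ : Ed d → ℝ) (s : ℝ) (p : ℝ≥0∞) (f : Ed d → ℂ) : ℝ≥0∞ :=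
  ∑' n : ℤ, ENNReal.ofReal (((2:ℝ) ^ n) ^ s) * eLpNorm (LPD d φ ((2:ℝ) ^ n) f) p volume

/-- The Hardy–Littlewood maximal function (with values in `ℝ≥0∞`). -/
def HLMax (d : ℕ) (g : Ed d → ℂ) (x : Ed d) : ℝ≥0∞ :=
  ⨆ r ∈ Ioi (0:ℝ), (volume (ball x r))⁻¹ * ∫⁻ y in ball x r, ‖g y‖₊


section Symbol

variable {d : ℕ} {φ : Ed d → ℝ}

/-- The symbol of the Littlewood–Paley projection `P_N`. -/
def lpSymbol (d : ℕ) (φ : Ed d → ℝ) (N : ℝ) (ξ : Ed d) : ℂ :=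
  ((φ (N⁻¹ • ξ) - φ ((2 / N) • ξ) : ℝ) : ℂ)

lemma contDiff_lpSymbol (hφ : IsLPBumpD d φ) (N : ℝ) :
    ContDiff ℝ (⊤ : ℕ∞) (lpSymbol d φ N) := by
  refine Complex.ofRealCLM.contDiff.comp ?_
  exact (hφ.smooth.comp (contDiff_const_smul _)).sub (hφ.smooth.comp (contDiff_const_smul _))

lemma norm_bounds_of_lpSymbol_ne_zero (hφ : IsLPBumpD d φ) {N : ℝ} (hN : 0 < N) {ξ : Ed d}
    (h : lpSymbol d φ N ξ ≠ 0) : N / 2 < ‖ξ‖ ∧ ‖ξ‖ < 2 * N := by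
  constructor
  · by_contra! hξ
    apply h
    have h₁ : ‖N⁻¹ • ξ‖ ≤ 1 := by
      rw [norm_smul, Real.norm_of_nonneg (by positivity), inv_mul_le_iff₀ hN]; linarith
    have h₂ : ‖(2 / N) • ξ‖ ≤ 1 := by
      rw [norm_smul, Real.norm_of_nonneg (by positivity), div_mul_eq_mul_div, div_le_one hN]
      linarith
    simp [lpSymbol, hφ.eq_one _ h₁, hφ.eq_one _ h₂]
  · by_contra! hξ
    apply h
    have h₁ : 2 ≤ ‖N⁻¹ • ξ‖ := by
      rw [norm_smul, Real.norm_of_nonneg (by positivity), le_inv_mul_iff₀ hN]; linarith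
    have h₂ : 2 ≤ ‖(2 / N) • ξ‖ := by
      rw [norm_smul, Real.norm_of_nonneg (by positivity), div_mul_eq_mul_div, le_div_iff₀ hN]
      linarith
    simp [lpSymbol, hφ.eq_zero _ h₁, hφ.eq_zero _ h₂]

lemma norm_lpSymbol_le_one (hφ : IsLPBumpD d φ) (N : ℝ) (ξ : Ed d) : ‖lpSymbol d φ N ξ‖ ≤ 1 := by
  obtain ⟨h₁, h₂⟩ := hφ.mem_Icc (N⁻¹ • ξ)
  obtain ⟨h₃, h₄⟩ := hφ.mem_Icc ((2 / N) • ξ)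
  rw [lpSymbol, Complex.norm_real, Real.norm_eq_abs, abs_le]
  constructor <;> linarith

lemma hasCompactSupport_lpSymbol (hφ : IsLPBumpD d φ) {N : ℝ} (hN : 0 < N) :
    HasCompactSupport (lpSymbol d φ N) := by
  refine HasCompactSupport.intro (isCompact_closedBall 0 (2 * N)) fun ξ hξ => ?_
  by_contra h
  exact hξ (by simpa using (norm_bounds_of_lpSymbol_ne_zero hφ hN h).2.le)

/-- The symbol of `P_N` as a Schwartz function. -/
def lpSchwartz (hφ : IsLPBumpD d φ) {N : ℝ} (hN : 0 < N) : 𝓢(Ed d, ℂ) :=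
  (hasCompactSupport_lpSymbol hφ hN).toSchwartzMap (contDiff_lpSymbol hφ N)

lemma lpSchwartz_apply (hφ : IsLPBumpD d φ) {N : ℝ} (hN : 0 < N) (ξ : Ed d) :
    lpSchwartz hφ hN ξ = lpSymbol d φ N ξ := rfl

/-- `P_N g` as a Schwartz function, for Schwartz `g`. -/
def lpProj (hφ : IsLPBumpD d φ) {N : ℝ} (hN : 0 < N) (g : 𝓢(Ed d, ℂ)) : 𝓢(Ed d, ℂ) :=
  SchwartzMap.convolution (ContinuousLinearMap.mul ℂ ℂ) (𝓕⁻ (lpSchwartz hφ hN)) g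

lemma fourier_lpProj (hφ : IsLPBumpD d φ) {N : ℝ} (hN : 0 < N) (g : 𝓢(Ed d, ℂ)) (ξ : Ed d) :
    𝓕 (lpProj hφ hN g) ξ = lpSymbol d φ N ξ * 𝓕 g ξ := by
  simp [lpProj, SchwartzMap.fourier_convolution, lpSchwartz_apply]

lemma LPD_eq_lpProj (hφ : IsLPBumpD d φ) {N : ℝ} (hN : 0 < N) (g : 𝓢(Ed d, ℂ)) :
    LPD d φ N g = lpProj hφ hN g := by
  have h : (fun ξ => lpSymbol d φ N ξ * 𝓕 (g : Ed d → ℂ) ξ) = (𝓕 (lpProj hφ hN g) : 𝓢(Ed d, ℂ)) := by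
    ext ξ
    rw [fourier_lpProj, SchwartzMap.fourier_coe]
  change 𝓕⁻ (fun ξ => lpSymbol d φ N ξ * 𝓕 (g : Ed d → ℂ) ξ) = _
  rw [h, ← SchwartzMap.fourierInv_coe, FourierTransform.fourierInv_fourier_eq]

lemma lpProj_apply_eq_integral_kernel (hφ : IsLPBumpD d φ) {N : ℝ} (hN : 0 < N)
    (g : 𝓢(Ed d, ℂ)) (x : Ed d) :
    lpProj hφ hN g x = ∫ y, 𝓕⁻ (lpSchwartz hφ hN) (x - y) * g y := by
  rw [lpProj, SchwartzMap.convolution_apply, convolution_eq_swap]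
  rfl

lemma lpProj_apply_eq_fourier_integral (hφ : IsLPBumpD d φ) {N : ℝ} (hN : 0 < N)
    (g : 𝓢(Ed d, ℂ)) (x : Ed d) :
    lpProj hφ hN g x =
      ∫ ξ, Real.fourierChar (inner ℝ ξ x) • (lpSymbol d φ N ξ * 𝓕 g ξ) := by
  conv_lhs => rw [← FourierTransform.fourierInv_fourier_eq (F := 𝓢(Ed d, ℂ)) (lpProj hφ hN g),
    SchwartzMap.fourierInv_coe, Real.fourierInv_eq]
  simp_rw [fourier_lpProj]

lemma lpProj_eq_zero (hφ : IsLPBumpD d φ) {N : ℝ} (hN : 0 < N) (g : 𝓢(Ed d, ℂ))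
    (h : ∀ ξ, 𝓕 g ξ ≠ 0 → lpSymbol d φ N ξ = 0) : lpProj hφ hN g = 0 := by
  have : 𝓕 (lpProj hφ hN g) = 0 := by
    ext ξ
    rw [fourier_lpProj]
    by_cases h' : 𝓕 g ξ = 0
    · simp [h']
    · simp [h ξ h']
  rw [← FourierTransform.fourierInv_fourier_eq (F := 𝓢(Ed d, ℂ)) (lpProj hφ hN g), this]
  exact FourierTransform.fourierInv_zero ..

lemma lpSymbol_dyadic_eq_zero (hφ : IsLPBumpD d φ) {ξ : Ed d} {k v : ℤ}
    (h₁ : (2 : ℝ) ^ k ≤ ‖ξ‖) (h₂ : ‖ξ‖ < (2 : ℝ) ^ (k + 1))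
    (hv : v ∉ ({k, k + 1} : Finset ℤ)) : lpSymbol d φ ((2 : ℝ) ^ v) ξ = 0 := by
  by_contra h
  obtain ⟨h₃, h₄⟩ := norm_bounds_of_lpSymbol_ne_zero hφ (by positivity) h
  have h₅ : (2 : ℝ) ^ (v - 1) < 2 ^ (k + 1) := by
    rw [zpow_sub_one₀ two_ne_zero]; linarith
  have h₆ : (2 : ℝ) ^ k < 2 ^ (v + 1) := by
    rw [zpow_add_one₀ two_ne_zero]; linarith
  rw [zpow_lt_zpow_iff_right₀ one_lt_two] at h₅ h₆
  apply hv
  simp only [Finset.mem_insert, Finset.mem_singleton]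
  omega

lemma hasSum_lpSymbol (hφ : IsLPBumpD d φ) {ξ : Ed d} (hξ : ξ ≠ 0) :
    HasSum (fun v : ℤ => lpSymbol d φ ((2 : ℝ) ^ v) ξ) 1 := by
  obtain ⟨k, h₁, h₂⟩ := exists_mem_Ico_zpow (norm_pos_iff.2 hξ) (one_lt_two (α := ℝ))
  have h : HasSum (fun v : ℤ => lpSymbol d φ ((2 : ℝ) ^ v) ξ) _ :=
    hasSum_sum_of_ne_finset_zero fun v hv => lpSymbol_dyadic_eq_zero hφ h₁ h₂ hv
  convert h using 1
  have hk : (0 : ℝ) < 2 ^ k := by positivity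
  rw [zpow_add_one₀ two_ne_zero] at h₂
  have h₃ : φ (((2 : ℝ) ^ (k + 1))⁻¹ • ξ) = 1 := by
    apply hφ.eq_one
    rw [zpow_add_one₀ two_ne_zero, norm_smul, Real.norm_of_nonneg (by positivity),
      inv_mul_le_iff₀ (by positivity)]
    linarith
  have h₄ : φ ((2 / (2 : ℝ) ^ k) • ξ) = 0 := by
    apply hφ.eq_zero
    rw [norm_smul, Real.norm_of_nonneg (by positivity), div_mul_eq_mul_div, le_div_iff₀ hk]
    linarith
  have h₅ : (2 / (2 : ℝ) ^ (k + 1)) = ((2 : ℝ) ^ k)⁻¹ := by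
    rw [zpow_add_one₀ two_ne_zero]; field_simp
  rw [Finset.sum_pair (by omega)]
  simp [lpSymbol, h₃, h₄, h₅]

lemma tsum_enorm_lpSymbol_le (hφ : IsLPBumpD d φ) (ξ : Ed d) :
    ∑' v : ℤ, ‖lpSymbol d φ ((2 : ℝ) ^ v) ξ‖ₑ ≤ 2 := by
  have hle (v : ℤ) : ‖lpSymbol d φ ((2 : ℝ) ^ v) ξ‖ₑ ≤ 1 := by
    rw [← ofReal_norm]
    exact ENNReal.ofReal_le_one.2 (norm_lpSymbol_le_one hφ _ ξ)
  rcases eq_or_ne ξ 0 with rfl | hξ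
  · simp [lpSymbol]
  obtain ⟨k, h₁, h₂⟩ := exists_mem_Ico_zpow (norm_pos_iff.2 hξ) (one_lt_two (α := ℝ))
  rw [tsum_eq_sum (s := {k, k + 1}) fun v hv => by
    rw [lpSymbol_dyadic_eq_zero hφ h₁ h₂ hv, enorm_zero], Finset.sum_pair (by omega)]
  exact (add_le_add (hle _) (hle _)).trans_eq one_add_one_eq_two

end Symbol

section Maximal

variable {d : ℕ}

lemma setLIntegral_ball_le_HLMax (g : Ed d → ℂ) (x : Ed d) {r : ℝ} (hr : 0 < r) :
    ∫⁻ y in ball x r, ‖g y‖ₑ ≤ volume (ball x r) * HLMax d g x := by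
  have h : (volume (ball x r))⁻¹ * ∫⁻ y in ball x r, ‖g y‖ₑ ≤ HLMax d g x :=
    le_iSup₂ (f := fun r (_ : r ∈ Ioi (0 : ℝ)) =>
      (volume (ball x r))⁻¹ * ∫⁻ y in ball x r, (‖g y‖₊ : ℝ≥0∞)) r hr
  rwa [ENNReal.inv_mul_le_iff (measure_ball_pos volume x hr).ne' measure_ball_lt_top.ne] at h

lemma inv_one_add_pow_le_of_dyadic {t : ℝ} (ht : 0 ≤ t) (m : ℕ) :
    ∃ j : ℕ, t < 2 ^ j ∧ ((1 + t) ^ m)⁻¹ ≤ 2 ^ m * ((1 / 2) ^ j) ^ m := by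
  classical
  have hex : ∃ j : ℕ, t < 2 ^ j := pow_unbounded_of_one_lt t one_lt_two
  refine ⟨Nat.find hex, Nat.find_spec hex, ?_⟩
  rw [← mul_pow, ← inv_pow]
  refine pow_le_pow_left₀ (by positivity) ?_ m
  rcases h : Nat.find hex with _ | j
  · have : (1 + t)⁻¹ ≤ 1 := inv_le_one_of_one_le₀ (by linarith)
    norm_num
    linarith
  · have hj : ¬ t < 2 ^ j := Nat.find_min hex (by omega)
    have h₁ : (1 + t)⁻¹ ≤ ((2 : ℝ) ^ j)⁻¹ := inv_anti₀ (by positivity) (by linarith)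
    calc (1 + t)⁻¹ ≤ ((2 : ℝ) ^ j)⁻¹ := h₁
      _ = 2 * (1 / 2) ^ (j + 1) := by rw [pow_succ, one_div, inv_pow]; ring

/-- Kernels with an integrable radially decreasing majorant are dominated by the maximal
function, uniformly in the scale. -/
lemma lintegral_kernel_mul_le_HLMax {A N : ℝ} (hA : 0 ≤ A) (hN : 0 < N) {k : Ed d → ℂ}
    (hk : ∀ z, ‖k z‖ ≤ A * N ^ d * ((1 + N * ‖z‖) ^ (d + 1))⁻¹) {g : Ed d → ℂ}
    (hg : Measurable g) (x : Ed d) :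
    ∫⁻ y, ‖k (x - y)‖ₑ * ‖g y‖ₑ ≤
      ENNReal.ofReal (A * 2 ^ (d + 1) * 2) * volume (ball (0 : Ed d) 1) * HLMax d g x := by
  set c : ℕ → ℝ := fun j => A * N ^ d * (2 ^ (d + 1) * ((1 / 2) ^ j) ^ (d + 1)) with hc
  have hc0 (j : ℕ) : 0 ≤ c j := by positivity
  have hr (j : ℕ) : 0 < (2 : ℝ) ^ j / N := by positivity
  have hpt (y : Ed d) : ‖k (x - y)‖ₑ * ‖g y‖ₑ ≤
      ∑' j : ℕ, ENNReal.ofReal (c j) * (ball x (2 ^ j / N)).indicator (fun y => ‖g y‖ₑ) y := by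
    obtain ⟨j, hj, hj'⟩ := inv_one_add_pow_le_of_dyadic (t := N * ‖x - y‖) (by positivity) (d + 1)
    refine le_trans ?_ (ENNReal.le_tsum j)
    have hy : y ∈ ball x (2 ^ j / N) := by
      rw [mem_ball, dist_comm, dist_eq_norm, lt_div_iff₀ hN]
      linarith
    rw [indicator_of_mem hy, ← ofReal_norm (k (x - y))]
    gcongr
    refine (hk _).trans (mul_le_mul_of_nonneg_left hj' (by positivity))
  calc ∫⁻ y, ‖k (x - y)‖ₑ * ‖g y‖ₑ
      ≤ ∫⁻ y, ∑' j : ℕ, ENNReal.ofReal (c j) *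
          (ball x (2 ^ j / N)).indicator (fun y => ‖g y‖ₑ) y := lintegral_mono hpt
    _ = ∑' j : ℕ, ENNReal.ofReal (c j) * ∫⁻ y in ball x (2 ^ j / N), ‖g y‖ₑ := by
        rw [lintegral_tsum fun j =>
          ((hg.enorm.indicator measurableSet_ball).const_mul _).aemeasurable]
        refine tsum_congr fun j => ?_
        rw [lintegral_const_mul _ (hg.enorm.indicator measurableSet_ball),
          lintegral_indicator measurableSet_ball]
    _ ≤ ∑' j : ℕ, ENNReal.ofReal (A * 2 ^ (d + 1) * (1 / 2) ^ j) *
          (volume (ball (0 : Ed d) 1) * HLMax d g x) := by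
        refine ENNReal.tsum_le_tsum fun j => ?_
        grw [setLIntegral_ball_le_HLMax g x (hr j)]
        rw [Measure.addHaar_ball_of_pos _ _ (hr j), finrank_euclideanSpace_fin, ← mul_assoc,
          ← mul_assoc, ← mul_assoc, ← ENNReal.ofReal_mul (hc0 j)]
        refine mul_le_mul_left (mul_le_mul_left (ENNReal.ofReal_le_ofReal ?_) _) _
        simp only [hc]
        have h2 : ((1 : ℝ) / 2) ^ j * 2 ^ j = 1 := by rw [← mul_pow]; norm_num
        calc A * N ^ d * (2 ^ (d + 1) * ((1 / 2) ^ j) ^ (d + 1)) * (2 ^ j / N) ^ d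
            = A * 2 ^ (d + 1) * (1 / 2) ^ j * ((1 / 2) ^ j * 2 ^ j) ^ d * (N ^ d / N ^ d) := by
              rw [div_pow, mul_pow]; ring
          _ ≤ A * 2 ^ (d + 1) * (1 / 2) ^ j := by
              rw [h2, one_pow, div_self (by positivity), mul_one, mul_one]
    _ = _ := by
        rw [ENNReal.tsum_mul_right, ← ENNReal.ofReal_tsum_of_nonneg (fun j => by positivity)
          (summable_geometric_two.mul_left _), tsum_mul_left, tsum_geometric_two, ← mul_assoc]

variable {φ : Ed d → ℝ}

lemma fourierInv_lpSchwartz_scaling (hφ : IsLPBumpD d φ) {N : ℝ} (hN : 0 < N) (z : Ed d) :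
    (𝓕⁻ (lpSchwartz hφ hN) : 𝓢(Ed d, ℂ)) z =
      ((N ^ d : ℝ) : ℂ) * (𝓕⁻ (lpSchwartz hφ one_pos) : 𝓢(Ed d, ℂ)) (N • z) := by
  rw [SchwartzMap.fourierInv_coe, SchwartzMap.fourierInv_coe, Real.fourierInv_eq,
    Real.fourierInv_eq]
  have h := Measure.integral_comp_smul volume (fun ξ : Ed d =>
    Real.fourierChar (inner ℝ ξ (N • z)) • lpSchwartz hφ one_pos ξ) N⁻¹
  rw [finrank_euclideanSpace_fin, inv_pow, inv_inv, abs_of_nonneg (by positivity)] at h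
  rw [← Complex.real_smul, ← h]
  congr 1
  ext ξ
  have h₁ : inner ℝ (N⁻¹ • ξ) (N • z) = inner ℝ ξ z := by
    rw [real_inner_smul_left, real_inner_smul_right, inv_mul_cancel_left₀ hN.ne']
  rw [h₁, lpSchwartz_apply, lpSchwartz_apply, lpSymbol, lpSymbol]
  simp [smul_smul, div_eq_mul_inv]

/-- Littlewood–Paley projections are dominated by the maximal function. -/
lemma exists_enorm_lpProj_le_HLMax (hφ : IsLPBumpD d φ) :
    ∃ B : ℝ, 0 ≤ B ∧ ∀ {N : ℝ} (hN : 0 < N) (g : 𝓢(Ed d, ℂ)) (x : Ed d),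
      ‖lpProj hφ hN g x‖ₑ ≤ ENNReal.ofReal B * HLMax d g x := by
  set K : 𝓢(Ed d, ℂ) := 𝓕⁻ (lpSchwartz hφ one_pos)
  obtain ⟨A, hA, hK⟩ : ∃ A : ℝ, 0 ≤ A ∧ ∀ z, ‖K z‖ ≤ A * ((1 + ‖z‖) ^ (d + 1))⁻¹ := by
    obtain ⟨A, h⟩ : ∃ A : ℝ, ∀ z, (1 + ‖z‖) ^ (d + 1) * ‖K z‖ ≤ A := ⟨_, fun z => by
      simpa only [norm_iteratedFDeriv_zero] using
        SchwartzMap.one_add_le_sup_seminorm_apply (𝕜 := ℝ) (m := (d + 1, 0)) le_rfl le_rfl K z⟩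
    refine ⟨A, le_trans (by positivity) (h 0), fun z => ?_⟩
    rw [← div_eq_mul_inv, le_div_iff₀ (by positivity), mul_comm]
    exact h z
  refine ⟨A * 2 ^ (d + 1) * 2 * (volume (ball (0 : Ed d) 1)).toReal, by positivity,
    fun {N} hN g x => ?_⟩
  rw [lpProj_apply_eq_integral_kernel, ENNReal.ofReal_mul (by positivity),
    ENNReal.ofReal_toReal measure_ball_lt_top.ne]
  refine (enorm_integral_le_lintegral_enorm _).trans ?_
  simp_rw [enorm_mul]
  refine lintegral_kernel_mul_le_HLMax hA hN (fun z => ?_) g.continuous.measurable x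
  rw [fourierInv_lpSchwartz_scaling hφ hN, norm_mul, Complex.norm_real,
    Real.norm_of_nonneg (by positivity)]
  refine (mul_le_mul_of_nonneg_left (hK _) (by positivity)).trans_eq ?_
  rw [norm_smul, Real.norm_of_nonneg hN.le]
  ring

end Maximal

section Expansion

variable {d : ℕ}

lemma exists_add_eq_of_fourier_mul_ne_zero (f g : 𝓢(Ed d, ℂ)) {ξ : Ed d}
    (h : (𝓕 (pairing (ContinuousLinearMap.mul ℂ ℂ) f g) : 𝓢(Ed d, ℂ)) ξ ≠ 0) :
    ∃ a b, a + b = ξ ∧ (𝓕 f : 𝓢(Ed d, ℂ)) a ≠ 0 ∧ (𝓕 g : 𝓢(Ed d, ℂ)) b ≠ 0 := by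
  have hneg (u : 𝓢(Ed d, ℂ)) (ζ : Ed d) :
      (𝓕⁻ u : 𝓢(Ed d, ℂ)) ζ = (𝓕 u : 𝓢(Ed d, ℂ)) (-ζ) := rfl
  have hconv : (𝓕⁻ (pairing (ContinuousLinearMap.mul ℂ ℂ) f g) : 𝓢(Ed d, ℂ)) =
      SchwartzMap.convolution (ContinuousLinearMap.mul ℂ ℂ) (𝓕⁻ f) (𝓕⁻ g) := by
    simp [SchwartzMap.convolution]
  have h' : (𝓕⁻ (pairing (ContinuousLinearMap.mul ℂ ℂ) f g) : 𝓢(Ed d, ℂ)) (-ξ) ≠ 0 := by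
    rwa [hneg, neg_neg]
  rw [hconv, SchwartzMap.convolution_apply] at h'
  obtain ⟨a, ha, b, hb, hab⟩ := Set.mem_add.1 (support_convolution_subset _ h')
  exact ⟨-a, -b, by rw [← neg_add, hab, neg_neg], ha, hb⟩

/-- A product of Schwartz functions is Schwartz, and its Fourier support lies in the sum of the
Fourier supports of the factors. -/
lemma exists_schwartz_prod (n : ℕ) (g : Fin (n + 1) → 𝓢(Ed d, ℂ)) :
    ∃ G : 𝓢(Ed d, ℂ), (∀ y, G y = ∏ i, g i y) ∧
      ∀ ξ, (𝓕 G : 𝓢(Ed d, ℂ)) ξ ≠ 0 →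
        ∃ η : Fin (n + 1) → Ed d, (∀ i, (𝓕 (g i) : 𝓢(Ed d, ℂ)) (η i) ≠ 0) ∧ ∑ i, η i = ξ := by
  induction n with
  | zero =>
    exact ⟨g 0, fun y => by simp, fun ξ hξ =>
      ⟨fun _ => ξ, fun i => by rwa [Fin.fin_one_eq_zero i], by simp⟩⟩
  | succ n ih =>
    obtain ⟨G, hG, hsupp⟩ := ih fun i => g i.succ
    refine ⟨pairing (ContinuousLinearMap.mul ℂ ℂ) (g 0) G, fun y => ?_, fun ξ hξ => ?_⟩
    · rw [Fin.prod_univ_succ, ← hG]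
      rfl
    · obtain ⟨a, b, hab, ha, hb⟩ := exists_add_eq_of_fourier_mul_ne_zero _ _ hξ
      obtain ⟨η, hη, hsum⟩ := hsupp b hb
      refine ⟨Fin.cons a η, fun i => ?_, by simpa [Fin.sum_univ_succ, hsum] using hab⟩
      cases i using Fin.cases with
      | zero => simpa using ha
      | succ i => simpa using hη i

lemma hasSum_pi_prod {ι R : Type*} [NormedField R] [CompleteSpace R] {a : ι → R} {s : R}
    (ha : Summable fun i => ‖a i‖) (hs : HasSum a s) (n : ℕ) :
    (Summable fun v : Fin n → ι => ‖∏ i, a (v i)‖) ∧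
      HasSum (fun v : Fin n → ι => ∏ i, a (v i)) (s ^ n) := by
  induction n with
  | zero =>
    refine ⟨Summable.of_finite, ?_⟩
    simp
  | succ n ih =>
    have h₁ : Summable fun p : ι × (Fin n → ι) => ‖a p.1 * ∏ i, a (p.2 i)‖ :=
      Summable.mul_norm (f := a) (g := fun v : Fin n → ι => ∏ i, a (v i)) ha ih.1
    have h₂ := hs.mul ih.2 h₁.of_norm
    rw [← (Fin.consEquiv fun _ : Fin (n + 1) => ι).summable_iff,
      ← (Fin.consEquiv fun _ : Fin (n + 1) => ι).hasSum_iff, pow_succ']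
    simp only [Function.comp_def, Fin.consEquiv_apply, Fin.prod_univ_succ, Fin.cons_zero,
      Fin.cons_succ]
    exact ⟨h₁, h₂⟩

variable {φ : Ed d → ℝ}

lemma summable_integral_norm_lpSymbol_mul (hφ : IsLPBumpD d φ) (g : 𝓢(Ed d, ℂ)) :
    Summable fun v : ℤ => ∫ ξ, ‖lpSymbol d φ ((2 : ℝ) ^ v) ξ * g ξ‖ := by
  have hm (v : ℤ) : Continuous fun ξ => lpSymbol d φ ((2 : ℝ) ^ v) ξ * g ξ :=
    (contDiff_lpSymbol hφ _).continuous.mul g.continuous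
  refine (summable_congr fun v =>
    integral_norm_eq_lintegral_enorm (hm v).aestronglyMeasurable).2 ?_
  apply ENNReal.summable_toReal
  rw [← lintegral_tsum fun v => (hm v).measurable.enorm.aemeasurable]
  refine ne_top_of_le_ne_top (b := ∫⁻ ξ, 2 * ‖g ξ‖ₑ) ?_ (lintegral_mono fun ξ => ?_)
  · rw [lintegral_const_mul _ g.continuous.measurable.enorm]
    exact ENNReal.mul_ne_top ENNReal.ofNat_ne_top g.integrable.hasFiniteIntegral.ne
  · simp_rw [enorm_mul, ENNReal.tsum_mul_right]
    gcongr
    exact tsum_enorm_lpSymbol_le hφ ξ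

lemma norm_lpProj_le_integral (hφ : IsLPBumpD d φ) {N : ℝ} (hN : 0 < N) (g : 𝓢(Ed d, ℂ))
    (x : Ed d) :
    ‖lpProj hφ hN g x‖ ≤ ∫ ξ, ‖lpSymbol d φ N ξ * (𝓕 g : 𝓢(Ed d, ℂ)) ξ‖ := by
  rw [lpProj_apply_eq_fourier_integral]
  refine (norm_integral_le_integral_norm _).trans_eq ?_
  simp_rw [Circle.norm_smul]

/-- The Littlewood–Paley decomposition of a Schwartz function converges pointwise. -/
lemma hasSum_lpProj (hd : 1 ≤ d) (hφ : IsLPBumpD d φ) (g : 𝓢(Ed d, ℂ)) (x : Ed d) :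
    HasSum (fun v : ℤ => lpProj hφ (zpow_pos (two_pos (α := ℝ)) v) g x) (g x) := by
  have : NeZero d := ⟨by omega⟩
  set F : ℤ → Ed d → ℂ := fun v ξ => Real.fourierChar (inner ℝ ξ x) •
    (lpSymbol d φ ((2 : ℝ) ^ v) ξ * (𝓕 g : 𝓢(Ed d, ℂ)) ξ) with hF
  have hint (v : ℤ) : Integrable (F v) := by
    have hcont : Continuous (F v) := by
      have h₁ : Continuous fun ξ : Ed d => Real.fourierChar (inner ℝ ξ x) :=
        Real.continuous_fourierChar.comp (continuous_id.inner continuous_const)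
      exact h₁.smul
        ((contDiff_lpSymbol hφ _).continuous.mul (𝓕 g : 𝓢(Ed d, ℂ)).continuous)
    refine (𝓕 g : 𝓢(Ed d, ℂ)).integrable.norm.mono' hcont.aestronglyMeasurable
      (Filter.Eventually.of_forall fun ξ => ?_)
    rw [hF, Circle.norm_smul, norm_mul]
    exact mul_le_of_le_one_left (norm_nonneg _) (norm_lpSymbol_le_one hφ _ ξ)
  have hsum : Summable fun v => ∫ ξ, ‖F v ξ‖ := by
    simp_rw [hF, Circle.norm_smul]
    exact summable_integral_norm_lpSymbol_mul hφ (𝓕 g)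
  have h := hasSum_integral_of_summable_integral_norm hint hsum
  have hinv : ∫ ξ, Real.fourierChar (inner ℝ ξ x) • (𝓕 g : 𝓢(Ed d, ℂ)) ξ = g x := by
    rw [← Real.fourierInv_eq, ← SchwartzMap.fourierInv_coe,
      FourierTransform.fourierInv_fourier_eq]
  simp_rw [lpProj_apply_eq_fourier_integral]
  have hg : g x = ∫ ξ, ∑' v, F v ξ := by
    rw [← hinv]
    refine integral_congr_ae ?_
    filter_upwards [Measure.ae_ne volume (0 : Ed d)] with ξ hξ
    have h₁ := ((hasSum_lpSymbol hφ hξ).mul_right ((𝓕 g : 𝓢(Ed d, ℂ)) ξ)).const_smul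
      (Real.fourierChar (inner ℝ ξ x))
    rw [one_mul] at h₁
    exact h₁.tsum_eq.symm
  rwa [hg]

end Expansion

section Paraproduct

lemma tsum_le_tsum_antitone {n : ℕ} {a : (Fin n → ℤ) → ℝ≥0∞}
    (ha : ∀ (σ : Equiv.Perm (Fin n)) v, a (v ∘ σ) = a v) :
    ∑' v, a v ≤ n.factorial * ∑' v, {v : Fin n → ℤ | Antitone v}.indicator a v := by
  have hle (v : Fin n → ℤ) :
      a v ≤ ∑ σ : Equiv.Perm (Fin n), {v : Fin n → ℤ | Antitone v}.indicator a (v ∘ σ) := by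
    have hanti : Antitone (v ∘ Tuple.sort fun i => -v i) := fun i j hij => by
      simpa using Tuple.monotone_sort (fun i => -v i) hij
    calc a v = {v : Fin n → ℤ | Antitone v}.indicator a (v ∘ Tuple.sort fun i => -v i) := by
          rw [indicator_of_mem (by exact hanti), ha]
      _ ≤ _ := Finset.single_le_sum (f := fun σ : Equiv.Perm (Fin n) =>
          {v : Fin n → ℤ | Antitone v}.indicator a (v ∘ σ)) (fun _ _ => zero_le)
          (Finset.mem_univ _)
  refine (ENNReal.tsum_le_tsum hle).trans_eq ?_
  rw [Summable.tsum_finsetSum fun _ _ => ENNReal.summable]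
  have hσ (σ : Equiv.Perm (Fin n)) :
      ∑' v : Fin n → ℤ, {v : Fin n → ℤ | Antitone v}.indicator a (v ∘ σ) =
        ∑' v, {v : Fin n → ℤ | Antitone v}.indicator a v :=
    (Equiv.arrowCongr σ.symm (Equiv.refl ℤ)).tsum_eq
      ({v : Fin n → ℤ | Antitone v}.indicator a)
  simp [hσ, Fintype.card_perm]

lemma dyadic_frequency_constraints {E : Type*} [NormedAddCommGroup E] {v : Fin 5 → ℤ}
    (hv : Antitone v) {n : ℤ} {η : Fin 5 → E}
    (hη : ∀ i, (2 : ℝ) ^ v i / 2 < ‖η i‖ ∧ ‖η i‖ < 2 * 2 ^ v i)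
    (hsum : (2 : ℝ) ^ n / 2 < ‖∑ i, η i‖ ∧ ‖∑ i, η i‖ < 2 * 2 ^ n) {C : ℝ} (hC : 32 ≤ C) :
    (2 : ℝ) ^ n / C ≤ 2 ^ v 0 ∧ ((2 : ℝ) ^ v 0 / C ≤ 2 ^ v 1 ∨ (2 : ℝ) ^ v 0 ≤ C * 2 ^ n) := by
  have hC0 : 0 < C := by linarith
  have hmono {i j : Fin 5} (hij : i ≤ j) : (2 : ℝ) ^ v j ≤ 2 ^ v i :=
    zpow_le_zpow_right₀ one_le_two (hv hij)
  have hn : (0 : ℝ) < 2 ^ n := by positivity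
  have h0 : (0 : ℝ) < 2 ^ v 0 := by positivity
  have h01 : (2 : ℝ) ^ v 1 ≤ 2 ^ v 0 := hmono (by decide)
  have h12 : (2 : ℝ) ^ v 2 ≤ 2 ^ v 1 := hmono (by decide)
  have h13 : (2 : ℝ) ^ v 3 ≤ 2 ^ v 1 := hmono (by decide)
  have h14 : (2 : ℝ) ^ v 4 ≤ 2 ^ v 1 := hmono (by decide)
  set S := η 1 + η 2 + η 3 + η 4 with hS
  have hSle : ‖S‖ ≤ 8 * 2 ^ v 1 := by
    have : ‖S‖ ≤ ‖η 1‖ + ‖η 2‖ + ‖η 3‖ + ‖η 4‖ := norm_add₄_le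
    linarith [hη 1, hη 2, hη 3, hη 4]
  have hsplit : ∑ i, η i = η 0 + S := by rw [Fin.sum_univ_five, hS]; abel
  rw [hsplit] at hsum
  constructor
  · rw [div_le_iff₀ hC0]
    nlinarith [norm_add_le (η 0) S, (hη 0).2, hsum.1]
  · by_contra! h
    have h₁ := h.1
    rw [lt_div_iff₀ hC0] at h₁
    have h₂ : 32 * (2 : ℝ) ^ v 1 ≤ 2 ^ v 1 * C := by
      rw [mul_comm]; gcongr
    have h₃ : ‖η 0‖ ≤ ‖η 0 + S‖ + ‖S‖ := norm_le_add_norm_add (η 0) S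
    nlinarith [(hη 0).1, hsum.2, h.2]

variable {d : ℕ} {φ : Ed d → ℝ}

/-- A product of Littlewood–Paley pieces of `g`, as a Schwartz function. -/
def lpProd (hφ : IsLPBumpD d φ) (g : 𝓢(Ed d, ℂ)) {n : ℕ} (v : Fin (n + 1) → ℤ) : 𝓢(Ed d, ℂ) :=
  (exists_schwartz_prod n fun i => lpProj hφ (zpow_pos (two_pos (α := ℝ)) (v i)) g).choose

lemma lpProd_apply (hφ : IsLPBumpD d φ) (g : 𝓢(Ed d, ℂ)) {n : ℕ} (v : Fin (n + 1) → ℤ)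
    (y : Ed d) :
    lpProd hφ g v y = ∏ i, lpProj hφ (zpow_pos (two_pos (α := ℝ)) (v i)) g y :=
  (exists_schwartz_prod n fun i =>
    lpProj hφ (zpow_pos (two_pos (α := ℝ)) (v i)) g).choose_spec.1 y

lemma exists_sum_eq_of_fourier_lpProd_ne_zero (hφ : IsLPBumpD d φ) (g : 𝓢(Ed d, ℂ)) {n : ℕ}
    (v : Fin (n + 1) → ℤ) {ξ : Ed d} (hξ : (𝓕 (lpProd hφ g v) : 𝓢(Ed d, ℂ)) ξ ≠ 0) :
    ∃ η : Fin (n + 1) → Ed d,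
      (∀ i, (2 : ℝ) ^ v i / 2 < ‖η i‖ ∧ ‖η i‖ < 2 * 2 ^ v i) ∧ ∑ i, η i = ξ := by
  obtain ⟨η, hη, hsum⟩ := (exists_schwartz_prod n fun i =>
    lpProj hφ (zpow_pos (two_pos (α := ℝ)) (v i)) g).choose_spec.2 ξ hξ
  refine ⟨η, fun i => ?_, hsum⟩
  have h := hη i
  rw [fourier_lpProj] at h
  exact norm_bounds_of_lpSymbol_ne_zero hφ (by positivity) (left_ne_zero_of_mul h)

lemma lpProd_comp_perm (hφ : IsLPBumpD d φ) (g : 𝓢(Ed d, ℂ)) {n : ℕ} (v : Fin (n + 1) → ℤ)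
    (σ : Equiv.Perm (Fin (n + 1))) : lpProd hφ g (v ∘ σ) = lpProd hφ g v := by
  ext y
  rw [lpProd_apply, lpProd_apply]
  exact Equiv.prod_comp σ fun i => lpProj hφ (zpow_pos (two_pos (α := ℝ)) (v i)) g y

lemma enorm_lpProj_pow_le_tsum (hd : 1 ≤ d) (hφ : IsLPBumpD d φ) {N : ℝ} (hN : 0 < N)
    (g G : 𝓢(Ed d, ℂ)) {n : ℕ} (hG : ∀ y, G y = g y ^ (n + 1)) (x : Ed d) :
    ‖lpProj hφ hN G x‖ₑ ≤ ∑' v : Fin (n + 1) → ℤ, ‖lpProj hφ hN (lpProd hφ g v) x‖ₑ := by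
  set K : 𝓢(Ed d, ℂ) := 𝓕⁻ (lpSchwartz hφ hN) with hK
  set b : ℤ → ℝ := fun v => ∫ ξ, ‖lpSymbol d φ ((2 : ℝ) ^ v) ξ * (𝓕 g : 𝓢(Ed d, ℂ)) ξ‖ with hb
  have hb0 (v : ℤ) : 0 ≤ b v := integral_nonneg fun _ => norm_nonneg _
  have hbsum : Summable b := summable_integral_norm_lpSymbol_mul hφ (𝓕 g)
  have hKint : Integrable fun y => K (x - y) := K.integrable.comp_sub_left x
  have hle (v : Fin (n + 1) → ℤ) (y : Ed d) :
      ‖K (x - y) * lpProd hφ g v y‖ ≤ ‖K (x - y)‖ * ∏ i, b (v i) := by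
    rw [norm_mul, lpProd_apply, norm_prod]
    gcongr with i
    exact norm_lpProj_le_integral hφ _ g y
  have hint (v : Fin (n + 1) → ℤ) : Integrable fun y => K (x - y) * lpProd hφ g v y :=
    (hKint.norm.mul_const _).mono'
      (hKint.aestronglyMeasurable.mul (lpProd hφ g v).continuous.aestronglyMeasurable)
      (Filter.Eventually.of_forall (hle v))
  have hsum : Summable fun v : Fin (n + 1) → ℤ => ∫ y, ‖K (x - y) * lpProd hφ g v y‖ := by
    have hprod : Summable fun v : Fin (n + 1) → ℤ => ∏ i, b (v i) :=
      (hasSum_pi_prod hbsum.norm hbsum.hasSum (n + 1)).2.summable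
    refine Summable.of_nonneg_of_le (fun v => integral_nonneg fun _ => norm_nonneg _)
      (fun v => ?_) (hprod.mul_left (∫ y, ‖K (x - y)‖))
    rw [← integral_mul_const]
    exact integral_mono (hint v).norm (hKint.norm.mul_const _) (hle v)
  have hG' : lpProj hφ hN G x = ∑' v : Fin (n + 1) → ℤ, lpProj hφ hN (lpProd hφ g v) x := by
    simp_rw [lpProj_apply_eq_integral_kernel]
    rw [(hasSum_integral_of_summable_integral_norm hint hsum).tsum_eq]
    refine integral_congr_ae (Filter.Eventually.of_forall fun y => ?_)
    have hy := (hasSum_pi_prod (Summable.of_nonneg_of_le (fun _ => norm_nonneg _)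
      (fun v => norm_lpProj_le_integral hφ (zpow_pos (two_pos (α := ℝ)) v) g y) hbsum)
      (hasSum_lpProj hd hφ g y) (n + 1)).2.mul_left (K (x - y))
    simp only [hG, lpProd_apply]
    exact hy.tsum_eq.symm
  rw [hG']
  exact enorm_tsum_le_tsum_enorm

lemma enorm_lpProj_lpProd_le (hφ : IsLPBumpD d φ) {B : ℝ}
    (hB : ∀ {N : ℝ} (hN : 0 < N) (g : 𝓢(Ed d, ℂ)) (x : Ed d),
      ‖lpProj hφ hN g x‖ₑ ≤ ENNReal.ofReal B * HLMax d g x)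
    {C : ℝ} (hC : 32 ≤ C) (g : 𝓢(Ed d, ℂ)) (n : ℤ) (x : Ed d) {v : Fin 5 → ℤ}
    (hv : Antitone v) :
    ‖lpProj hφ (zpow_pos (two_pos (α := ℝ)) n) (lpProd hφ g v) x‖ₑ ≤ ENNReal.ofReal B *
      ({v : Fin 5 → ℤ | Antitone v ∧ (2 : ℝ) ^ v 0 / C ≤ 2 ^ v 1 ∧
          (2 : ℝ) ^ n / C ≤ 2 ^ v 0}.indicator (fun v => HLMax d (lpProd hφ g v) x) v +
        {v : Fin 5 → ℤ | Antitone v ∧ (2 : ℝ) ^ n / C ≤ 2 ^ v 0 ∧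
          (2 : ℝ) ^ v 0 ≤ C * 2 ^ n}.indicator (fun v => HLMax d (lpProd hφ g v) x) v) := by
  by_cases h0 : ∀ ξ, (𝓕 (lpProd hφ g v) : 𝓢(Ed d, ℂ)) ξ ≠ 0 → lpSymbol d φ ((2 : ℝ) ^ n) ξ = 0
  · rw [lpProj_eq_zero hφ _ _ h0]
    simp
  push Not at h0
  obtain ⟨ξ, hξ, hξn⟩ := h0
  obtain ⟨η, hη, rfl⟩ := exists_sum_eq_of_fourier_lpProd_ne_zero hφ g v hξ
  refine (hB _ _ x).trans (mul_le_mul_right ?_ _)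
  obtain ⟨h₁, h₂ | h₂⟩ := dyadic_frequency_constraints hv hη
    (norm_bounds_of_lpSymbol_ne_zero hφ (by positivity) hξn) hC
  · rw [indicator_of_mem (s := {v : Fin 5 → ℤ | Antitone v ∧ (2 : ℝ) ^ v 0 / C ≤ 2 ^ v 1 ∧
      (2 : ℝ) ^ n / C ≤ 2 ^ v 0}) ⟨hv, h₂, h₁⟩]
    exact le_self_add
  · rw [indicator_of_mem (s := {v : Fin 5 → ℤ | Antitone v ∧ (2 : ℝ) ^ n / C ≤ 2 ^ v 0 ∧
      (2 : ℝ) ^ v 0 ≤ C * 2 ^ n}) ⟨hv, h₁, h₂⟩]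
    exact le_add_self

end Paraproduct

/-- **Paraproduct decompositions for a fifth power.** -/
theorem paraproduct_fifth_power (d : ℕ) (hd : 1 ≤ d)
    (φ : Ed d → ℝ) (hφ : IsLPBumpD d φ) :
    ∃ C : ℝ, 1 ≤ C ∧
      ∀ (f : 𝓢(Ed d, ℝ)) (n : ℤ) (x : Ed d),
        (ENNReal.ofReal ‖LPD d φ ((2:ℝ) ^ n) (fun y => ((f y : ℂ)) ^ 5) x‖ ≤
          ENNReal.ofReal C *
            ((∑' v : {v : Fin 5 → ℤ // Antitone v ∧
                  (2:ℝ) ^ (v 0) / C ≤ (2:ℝ) ^ (v 1) ∧ (2:ℝ) ^ n / C ≤ (2:ℝ) ^ (v 0)},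
                HLMax d (fun y => ∏ i : Fin 5, LPD d φ ((2:ℝ) ^ (v.1 i)) (fun z => (f z : ℂ)) y) x) +
             (∑' v : {v : Fin 5 → ℤ // Antitone v ∧
                  (2:ℝ) ^ n / C ≤ (2:ℝ) ^ (v 0) ∧ (2:ℝ) ^ (v 0) ≤ C * (2:ℝ) ^ n},
                HLMax d (fun y => ∏ i : Fin 5, LPD d φ ((2:ℝ) ^ (v.1 i)) (fun z => (f z : ℂ)) y) x))) ∧
        (ENNReal.ofReal ‖LPD d φ ((2:ℝ) ^ n) (fun y => ((f y : ℂ)) ^ 5) x‖ ≤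
          ENNReal.ofReal (2 * C) *
            ∑' v : {v : Fin 5 → ℤ // Antitone v ∧ (2:ℝ) ^ n / C ≤ (2:ℝ) ^ (v 0)},
              HLMax d (fun y => ∏ i : Fin 5, LPD d φ ((2:ℝ) ^ (v.1 i)) (fun z => (f z : ℂ)) y) x) := by
  obtain ⟨B, hB0, hB⟩ := exists_enorm_lpProj_le_HLMax hφ
  set C : ℝ := max 32 (120 * B) with hCdef
  have hC : 32 ≤ C := le_max_left _ _
  refine ⟨C, by linarith, fun f n x => ?_⟩
  set g : 𝓢(Ed d, ℂ) := f.postcompCLM Complex.ofRealCLM with hg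
  have hgf : (fun z => (f z : ℂ)) = g := rfl
  obtain ⟨G, hG, -⟩ := exists_schwartz_prod 4 fun _ => g
  have hG5 (y : Ed d) : G y = g y ^ 5 := by rw [hG, Fin.prod_const]
  have hfG : (fun y => (f y : ℂ) ^ 5) = G := by
    ext y
    rw [hG5]
    rfl
  have hprod (v : Fin 5 → ℤ) :
      (fun y => ∏ i : Fin 5, LPD d φ ((2:ℝ) ^ (v i)) (fun z => (f z : ℂ)) y) = lpProd hφ g v := by
    ext y
    rw [lpProd_apply]
    exact Finset.prod_congr rfl fun i _ => by
      rw [hgf, LPD_eq_lpProj hφ (zpow_pos (two_pos (α := ℝ)) (v i))]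
  rw [hfG, LPD_eq_lpProj hφ (zpow_pos (two_pos (α := ℝ)) n), ofReal_norm]
  simp_rw [hprod]
  set h : (Fin 5 → ℤ) → ℝ≥0∞ := fun v => HLMax d (lpProd hφ g v) x
  set S₁ : Set (Fin 5 → ℤ) :=
    {v | Antitone v ∧ (2 : ℝ) ^ v 0 / C ≤ 2 ^ v 1 ∧ (2 : ℝ) ^ n / C ≤ 2 ^ v 0}
  set S₂ : Set (Fin 5 → ℤ) :=
    {v | Antitone v ∧ (2 : ℝ) ^ n / C ≤ 2 ^ v 0 ∧ (2 : ℝ) ^ v 0 ≤ C * 2 ^ n}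
  set S₃ : Set (Fin 5 → ℤ) := {v | Antitone v ∧ (2 : ℝ) ^ n / C ≤ 2 ^ v 0}
  have main : ‖lpProj hφ (zpow_pos (two_pos (α := ℝ)) n) G x‖ₑ ≤
      ENNReal.ofReal C * ((∑' v : S₁, h v) + ∑' v : S₂, h v) := by
    calc ‖lpProj hφ (zpow_pos (two_pos (α := ℝ)) n) G x‖ₑ
        ≤ ∑' v : Fin 5 → ℤ, ‖lpProj hφ (zpow_pos (two_pos (α := ℝ)) n) (lpProd hφ g v) x‖ₑ :=
          enorm_lpProj_pow_le_tsum hd hφ _ g G hG5 x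
      _ ≤ (Nat.factorial 5 : ℕ) * ∑' v, {v : Fin 5 → ℤ | Antitone v}.indicator
            (fun v => ‖lpProj hφ (zpow_pos (two_pos (α := ℝ)) n) (lpProd hφ g v) x‖ₑ) v :=
          tsum_le_tsum_antitone fun σ v => by rw [lpProd_comp_perm]
      _ ≤ (Nat.factorial 5 : ℕ) *
            ∑' v, ENNReal.ofReal B * (S₁.indicator h v + S₂.indicator h v) := by
          gcongr with v
          exact indicator_le (fun v hv => enorm_lpProj_lpProd_le hφ hB hC g n x hv) v
      _ = ENNReal.ofReal (120 * B) * ((∑' v : S₁, h v) + ∑' v : S₂, h v) := by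
          rw [ENNReal.tsum_mul_left, ENNReal.tsum_add, tsum_subtype, tsum_subtype, ← mul_assoc,
            ENNReal.ofReal_mul (by norm_num)]
          norm_num [Nat.factorial]
      _ ≤ ENNReal.ofReal C * ((∑' v : S₁, h v) + ∑' v : S₂, h v) := by
          gcongr
          exact le_max_right _ _
  refine ⟨main, main.trans ?_⟩
  have h₁ : ∑' v : S₁, h v ≤ ∑' v : S₃, h v :=
    ENNReal.tsum_mono_subtype h fun v hv => ⟨hv.1, hv.2.2⟩
  have h₂ : ∑' v : S₂, h v ≤ ∑' v : S₃, h v :=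
    ENNReal.tsum_mono_subtype h fun v hv => ⟨hv.1, hv.2.1⟩
  calc ENNReal.ofReal C * ((∑' v : S₁, h v) + ∑' v : S₂, h v)
      ≤ ENNReal.ofReal C * ((∑' v : S₃, h v) + ∑' v : S₃, h v) := by gcongr
    _ = ENNReal.ofReal (2 * C) * ∑' v : S₃, h v := by
        rw [← two_mul, ← mul_assoc, mul_comm 2 C, ENNReal.ofReal_mul (by linarith)]
        norm_num


end
end

section
/- (Frequency-localized dispersive estimate for the half wave.) Fix d ≥ 2 and 2 ≤ p ≤ ∞, and let p' = p/(p−1). There is a constant C (depending only on d, p, and the Littlewood–Paley bump φ) such that for every Schwartz function f on ℝ^d, every t ∈ ℝ, every dyadic N ∈ 2^ℤ, and either choice of sign, ‖ e^{±it|∇|} P_N f ‖_{L^p(ℝ^d)} ≤ C · N^{d(1−2/p)} · (1 + |t|N)^{−(d−1)(1/2 − 1/p)} · ‖ P_N f ‖_{L^{p'}(ℝ^d)}. -/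
open MeasureTheory SchwartzMap Metric Set
open scoped ENNReal NNReal FourierTransform RealInnerProductSpace

noncomputable section

/-- Multiplication formula for the Fourier transform. -/
theorem integral_mul_fourier_eq {V : Type*} [NormedAddCommGroup V] [InnerProductSpace ℝ V]
    [FiniteDimensional ℝ V] [MeasurableSpace V] [BorelSpace V] {f g : V → ℂ}
    (hf : Integrable f) (hg : Integrable g) :
    ∫ ξ, 𝓕 f ξ * g ξ = ∫ x, f x * 𝓕 g x := by
  simpa using! VectorFourier.integral_fourierIntegral_smul_eq_flip (L := innerₗ V)
    Real.continuous_fourierChar continuous_inner hf hg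

/-- Oscillatory Gaussian integrals against a Schwartz amplitude decay like `‖b‖ ^ (-n / 2)`. -/
theorem norm_integral_gaussian_mul_le {V : Type*} [NormedAddCommGroup V] [InnerProductSpace ℝ V]
    [FiniteDimensional ℝ V] [MeasurableSpace V] [BorelSpace V] (χ : 𝓢(V, ℂ)) (x : V) {b : ℂ}
    (hb : 0 < b.re) :
    ‖∫ ξ, Complex.exp (-b * ‖ξ‖ ^ 2 + 2 * Real.pi * Complex.I * ⟪x, ξ⟫) * χ ξ‖ ≤
      (Real.pi / ‖b‖) ^ ((Module.finrank ℝ V : ℝ) / 2) * ∫ y, ‖(𝓕⁻ χ) y‖ := by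
  have hb0 : b ≠ 0 := by rintro rfl; simp at hb
  set G : V → ℂ := fun ξ => Complex.exp (-b * ‖ξ‖ ^ 2 + 2 * Real.pi * Complex.I * ⟪x, ξ⟫) with hG
  have hGi : Integrable G := GaussianFourier.integrable_cexp_neg_mul_sq_norm_add hb _ x
  have h1 : ∫ ξ, G ξ * χ ξ = ∫ y, (𝓕⁻ χ) y * 𝓕 G y := by
    rw [← integral_mul_fourier_eq (𝓕⁻ χ).integrable hGi]
    refine integral_congr_ae (.of_forall fun ξ => ?_)
    have : 𝓕 (⇑(𝓕⁻ χ : 𝓢(V, ℂ))) ξ = χ ξ := by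
      rw [← fourier_coe, FourierTransform.fourier_fourierInv_eq]
    simp only [this, mul_comm]
  have h2 : ∀ y, ‖𝓕 G y‖ ≤ (Real.pi / ‖b‖) ^ ((Module.finrank ℝ V : ℝ) / 2) := by
    intro y
    rw [hG, fourier_gaussian_innerProductSpace' hb, norm_mul]
    have e1 : ‖((Real.pi : ℂ) / b) ^ ((Module.finrank ℝ V : ℂ) / 2)‖
        = (Real.pi / ‖b‖) ^ ((Module.finrank ℝ V : ℝ) / 2) := by
      have : ((Module.finrank ℝ V : ℂ) / 2) = (((Module.finrank ℝ V : ℝ) / 2 : ℝ) : ℂ) := by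
        push_cast; rfl
      rw [this, Complex.norm_cpow_real]
      simp [abs_of_pos Real.pi_pos]
    have e2 : ‖Complex.exp (-Real.pi ^ 2 * ‖x - y‖ ^ 2 / b)‖ ≤ 1 := by
      rw [Complex.norm_exp, Real.exp_le_one_iff]
      have : (-(Real.pi : ℂ) ^ 2 * ‖x - y‖ ^ 2 / b) =
          ((-(Real.pi ^ 2 * ‖x - y‖ ^ 2) : ℝ) : ℂ) * b⁻¹ := by
        push_cast; ring
      rw [this, Complex.re_ofReal_mul, Complex.inv_re]
      apply mul_nonpos_of_nonpos_of_nonneg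
      · simp; positivity
      · exact div_nonneg hb.le (Complex.normSq_nonneg _)
    rw [e1]
    exact mul_le_of_le_one_right (by positivity) e2
  rw [h1, ← integral_const_mul]
  refine (norm_integral_le_integral_norm _).trans ?_
  refine integral_mono_of_nonneg (.of_forall fun _ => norm_nonneg _)
    ((𝓕⁻ χ).integrable.norm.const_mul _) (.of_forall fun y => ?_)
  simp only [norm_mul]
  rw [mul_comm]
  exact mul_le_mul_of_nonneg_right (h2 y) (norm_nonneg _)

/-- Dispersive decay for the Schrödinger kernel with a Schwartz amplitude. -/
theorem norm_integral_schrodinger_le {V : Type*} [NormedAddCommGroup V] [InnerProductSpace ℝ V]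
    [FiniteDimensional ℝ V] [MeasurableSpace V] [BorelSpace V] (χ : 𝓢(V, ℂ)) (x : V) {τ : ℝ}
    (hτ : τ ≠ 0) :
    ‖∫ ξ, Complex.exp (2 * Real.pi * Complex.I * (τ * ‖ξ‖ ^ 2 + ⟪x, ξ⟫ : ℝ)) * χ ξ‖ ≤
      |τ| ^ (-((Module.finrank ℝ V : ℝ) / 2)) * ∫ y, ‖(𝓕⁻ χ) y‖ := by
  have key : ∀ ε : ℝ, 0 < ε →
      ‖∫ ξ, Complex.exp (-((ε : ℂ) - 2 * Real.pi * τ * Complex.I) * ‖ξ‖ ^ 2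
        + 2 * Real.pi * Complex.I * ⟪x, ξ⟫) * χ ξ‖ ≤
      |τ| ^ (-((Module.finrank ℝ V : ℝ) / 2)) * ∫ y, ‖(𝓕⁻ χ) y‖ := by
    intro ε hε
    set b : ℂ := (ε : ℂ) - 2 * Real.pi * τ * Complex.I with hb
    have hre : b.re = ε := by simp [hb]
    have him : b.im = - (2 * Real.pi * τ) := by simp [hb]
    refine (norm_integral_gaussian_mul_le χ x (b := b) (by rw [hre]; exact hε)).trans ?_
    refine mul_le_mul_of_nonneg_right ?_ (integral_nonneg fun _ => norm_nonneg _)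
    rw [Real.rpow_neg (abs_nonneg _), ← Real.inv_rpow (abs_nonneg _)]
    refine Real.rpow_le_rpow (by positivity) ?_ (by positivity)
    have h1 : 2 * Real.pi * |τ| ≤ ‖b‖ := by
      have := Complex.abs_im_le_norm b
      rw [him, abs_neg, abs_mul, abs_of_pos (by positivity : (0:ℝ) < 2 * Real.pi)] at this
      exact this
    have h2 : 0 < |τ| := abs_pos.mpr hτ
    rw [div_le_iff₀ (lt_of_lt_of_le (by positivity) h1), inv_mul_eq_div, le_div_iff₀ h2]
    nlinarith [mul_pos Real.pi_pos h2]
  have lim : Filter.Tendsto (fun ε : ℝ =>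
      ∫ ξ, Complex.exp (-((ε : ℂ) - 2 * Real.pi * τ * Complex.I) * ‖ξ‖ ^ 2
        + 2 * Real.pi * Complex.I * ⟪x, ξ⟫) * χ ξ) (nhdsWithin 0 (Ioi 0))
      (nhds (∫ ξ, Complex.exp (2 * Real.pi * Complex.I * (τ * ‖ξ‖ ^ 2 + ⟪x, ξ⟫ : ℝ)) * χ ξ)) := by
    refine tendsto_integral_filter_of_dominated_convergence (fun ξ => ‖χ ξ‖) ?_ ?_
      χ.integrable.norm ?_
    · refine .of_forall fun ε => Continuous.aestronglyMeasurable ?_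
      have := χ.continuous
      fun_prop
    · filter_upwards [self_mem_nhdsWithin] with ε hε
      refine .of_forall fun ξ => ?_
      rw [norm_mul]
      refine mul_le_of_le_one_left (norm_nonneg _) ?_
      rw [Complex.norm_exp, Real.exp_le_one_iff]
      have hε : 0 < ε := hε
      have : (-((ε : ℂ) - 2 * Real.pi * τ * Complex.I) * ‖ξ‖ ^ 2
        + 2 * Real.pi * Complex.I * ⟪x, ξ⟫).re = -ε * ‖ξ‖ ^ 2 := by
        simp [← Complex.ofReal_pow]
      rw [this]
      nlinarith [mul_nonneg hε.le (sq_nonneg ‖ξ‖)]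
    · refine .of_forall fun ξ => ?_
      refine Filter.Tendsto.mul_const _ ?_
      have hc : Continuous fun ε : ℝ =>
          Complex.exp (-((ε : ℂ) - 2 * Real.pi * τ * Complex.I) * ‖ξ‖ ^ 2
        + 2 * Real.pi * Complex.I * ⟪x, ξ⟫) := by fun_prop
      refine (hc.tendsto' 0 _ ?_).mono_left nhdsWithin_le_nhds
      congr 1
      push_cast; ring
  refine le_of_tendsto lim.norm ?_
  filter_upwards [self_mem_nhdsWithin] with ε hε using key ε hε

/-- Nonstationary phase: repeated integration by parts for the phase `r - ρ r²` with `ρ` small. -/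
theorem exists_norm_integral_nonstationary_le {R : ℝ} (hR : 0 < R) (M : ℕ) :
    ∀ (l : ℕ) (a : ℝ → ℂ), ContDiff ℝ (⊤ : ℕ∞) a → tsupport a ⊆ Ioo (-R) R →
    ∃ C : ℝ, 0 ≤ C ∧ ∀ s ρ : ℝ, s ≠ 0 → |ρ| * (4 * R) ≤ 1 →
      ‖∫ r in (-R)..R, Complex.exp (2 * Real.pi * Complex.I * (s * (r - ρ * r ^ 2))) *
        (a r * (1 - 2 * ρ * r : ℂ)⁻¹ ^ l)‖ ≤ C * (|s| ^ M)⁻¹ := by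
  have hw : ∀ ρ r : ℝ, |ρ| * (4 * R) ≤ 1 → r ∈ Icc (-R) R → 1 / 2 ≤ 1 - 2 * ρ * r := by
    intro ρ r hρ hr
    have h1 : |r| ≤ R := abs_le.mpr hr
    have h2 : |ρ * r| ≤ 1 / 4 := by
      rw [abs_mul]
      nlinarith [mul_le_mul_of_nonneg_left h1 (abs_nonneg ρ)]
    have := (abs_le.mp h2).2
    linarith
  have hwc : ∀ ρ r : ℝ, |ρ| * (4 * R) ≤ 1 → r ∈ Icc (-R) R → (1 - 2 * ρ * r : ℂ) ≠ 0 := by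
    intro ρ r hρ hr h
    have h1 : ((1 - 2 * ρ * r : ℝ) : ℂ) = 0 := by push_cast; exact h
    have h2 := hw ρ r hρ hr
    rw [Complex.ofReal_eq_zero] at h1
    linarith
  induction M with
  | zero =>
    intro l a ha _
    obtain ⟨B, hB⟩ := (isCompact_Icc (a := -R) (b := R)).exists_bound_of_continuousOn
      ha.continuous.continuousOn
    have hB0 : 0 ≤ B := (norm_nonneg _).trans (hB 0 ⟨by linarith, hR.le⟩)
    refine ⟨B * 2 ^ l * |R - -R|, by positivity, fun s ρ hs hρ => ?_⟩
    simp only [pow_zero, inv_one, mul_one]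
    refine intervalIntegral.norm_integral_le_of_norm_le_const fun r hr => ?_
    rw [uIoc_of_le (by linarith)] at hr
    have hr' : r ∈ Icc (-R) R := Ioc_subset_Icc_self hr
    have e1 : ‖Complex.exp (2 * Real.pi * Complex.I * (s * (r - ρ * r ^ 2)))‖ = 1 := by
      have : (2 * Real.pi * Complex.I * (s * (r - ρ * r ^ 2)) : ℂ) =
        ((2 * Real.pi * (s * (r - ρ * r ^ 2)) : ℝ) : ℂ) * Complex.I := by push_cast; ring
      rw [this, Complex.norm_exp_ofReal_mul_I]
    rw [norm_mul, e1, one_mul, norm_mul, norm_pow, norm_inv]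
    have e2 : ‖(1 - 2 * ρ * r : ℂ)‖ = |1 - 2 * ρ * r| := by
      rw [← Real.norm_eq_abs, ← Complex.norm_real]; push_cast; rfl
    rw [e2]
    have e3 := hw ρ r hρ hr'
    have e4 : |1 - 2 * ρ * r|⁻¹ ≤ 2 := by
      rw [abs_of_pos (by linarith)]
      rw [inv_le_comm₀ (by linarith) (by norm_num)]
      linarith
    gcongr
    exact hB r hr'
  | succ M ih =>
    intro l a ha hsupp
    have hda : ContDiff ℝ (⊤ : ℕ∞) (deriv a) := by
      have : ContDiff ℝ ((⊤ : ℕ∞) + 1 : WithTop ℕ∞) a := by simpa using ha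
      exact (contDiff_succ_iff_deriv.mp this).2.2
    obtain ⟨C₁, hC₁, h₁⟩ := ih (l + 1) (deriv a) hda ((tsupport_deriv_subset).trans hsupp)
    obtain ⟨C₂, hC₂, h₂⟩ := ih (l + 2) a ha hsupp
    refine ⟨C₁ + (l + 1) * (2 * R)⁻¹ * C₂, by positivity, fun s ρ hs hρ => ?_⟩
    specialize h₁ s ρ hs hρ
    specialize h₂ s ρ hs hρ
    set e : ℝ → ℂ := fun r => Complex.exp (2 * Real.pi * Complex.I * (s * (r - ρ * r ^ 2))) with he
    set W : ℝ → ℂ := fun r => (1 - 2 * ρ * r : ℂ)⁻¹ with hW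
    have hle : -R ≤ R := by linarith
    have hec : Continuous e := by rw [he]; fun_prop
    have hWc : ContinuousOn W (Icc (-R) R) := by
      refine ContinuousOn.inv₀ (by fun_prop) fun r hr => hwc ρ r hρ hr
    have hde : ∀ r, HasDerivAt e (e r * (2 * Real.pi * Complex.I * s * (1 - 2 * ρ * r))) r := by
      intro r
      have h0 : HasDerivAt (fun r : ℝ => (r : ℂ)) 1 r := Complex.ofRealCLM.hasDerivAt
      have h1 : HasDerivAt (fun r : ℝ => (2 * Real.pi * Complex.I * (s * (r - ρ * r ^ 2)) : ℂ))
          (2 * Real.pi * Complex.I * (s * (1 - ρ * (2 * r)))) r := by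
        have := (((h0.sub ((h0.pow 2).const_mul (ρ : ℂ))).const_mul (s : ℂ)).const_mul
          (2 * Real.pi * Complex.I : ℂ))
        refine this.congr_deriv ?_
        simp
      refine h1.cexp.congr_deriv ?_
      simp only [he]; ring
    have hdW : ∀ r ∈ Icc (-R) R, HasDerivAt W (2 * ρ * W r ^ 2) r := by
      intro r hr
      have h0 : HasDerivAt (fun r : ℝ => (r : ℂ)) 1 r := Complex.ofRealCLM.hasDerivAt
      have h1 := (((h0.const_mul (2 * ρ : ℂ)).const_sub 1).inv (hwc ρ r hρ hr))
      refine h1.congr_deriv ?_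
      simp only [hW]
      have := hwc ρ r hρ hr
      field_simp
    have hda' : ∀ r, HasDerivAt a (deriv a r) r := fun r =>
      (ha.differentiable (by simp)).differentiableAt.hasDerivAt
    have hF : ∀ r ∈ uIcc (-R) R, HasDerivAt (fun r => e r * (a r * W r ^ (l + 1)))
        (2 * Real.pi * Complex.I * s * (e r * (a r * W r ^ l)) +
          e r * (deriv a r * W r ^ (l + 1)) +
          2 * ρ * (l + 1) * (e r * (a r * W r ^ (l + 2)))) r := by
      intro r hr
      rw [uIcc_of_le hle] at hr
      have := (hde r).mul ((hda' r).mul ((hdW r hr).pow (l + 1)))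
      refine this.congr_deriv ?_
      have hw1 : W r * (1 - 2 * ρ * r) = 1 := inv_mul_cancel₀ (hwc ρ r hρ hr)
      simp only [Nat.add_sub_cancel, Nat.cast_add, Nat.cast_one, Pi.mul_apply, Pi.pow_apply]
      linear_combination (2 * Real.pi * Complex.I * s * e r * a r * W r ^ l) * hw1
    have hi : ∀ (k : ℕ) (b : ℝ → ℂ), Continuous b →
        IntervalIntegrable (fun r => e r * (b r * W r ^ k)) volume (-R) R := by
      intro k b hb
      refine ContinuousOn.intervalIntegrable ?_
      rw [uIcc_of_le hle]
      exact hec.continuousOn.mul (hb.continuousOn.mul (hWc.pow k))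
    have hac := ha.continuous
    have hdac := hda.continuous
    have hz : ∀ r, r ∉ Ioo (-R) R → a r = 0 := fun r hr =>
      image_eq_zero_of_notMem_tsupport fun h => hr (hsupp h)
    have hI := intervalIntegral.integral_eq_sub_of_hasDerivAt hF
      (((hi l a hac).const_mul _ |>.add (hi (l + 1) _ hdac)).add ((hi (l + 2) a hac).const_mul _))
    rw [intervalIntegral.integral_add ((hi l a hac).const_mul _ |>.add (hi (l + 1) _ hdac))
      ((hi (l + 2) a hac).const_mul _),
      intervalIntegral.integral_add ((hi l a hac).const_mul _) (hi (l + 1) _ hdac),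
      intervalIntegral.integral_const_mul, intervalIntegral.integral_const_mul,
      hz R (by simp), hz (-R) (by simp)] at hI
    set I₀ := ∫ r in (-R)..R, e r * (a r * W r ^ l)
    set I₁ := ∫ r in (-R)..R, e r * (deriv a r * W r ^ (l + 1))
    set I₂ := ∫ r in (-R)..R, e r * (a r * W r ^ (l + 2))
    have hs' : 0 < |s| := abs_pos.mpr hs
    have e1 : 2 * Real.pi * Complex.I * s * I₀ = -(I₁ + 2 * ρ * (l + 1) * I₂) := by
      linear_combination hI
    have e2 : 2 * Real.pi * |s| * ‖I₀‖ ≤ ‖I₁‖ + 2 * |ρ| * (l + 1) * ‖I₂‖ := by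
      have := congrArg norm e1
      rw [norm_neg] at this
      have h3 := this.le.trans (norm_add_le _ _)
      have h4 : ‖(l + 1 : ℂ)‖ = l + 1 := by
        rw [← Nat.cast_add_one, Complex.norm_natCast]; push_cast; rfl
      simpa [h4, abs_of_pos Real.pi_pos] using h3
    have hρ' : 2 * |ρ| ≤ (2 * R)⁻¹ := by
      rw [← one_div, le_div_iff₀ (by positivity)]
      linarith
    have e3 : |s| * ‖I₀‖ ≤ (C₁ + (l + 1) * (2 * R)⁻¹ * C₂) * (|s| ^ M)⁻¹ := by
      have hpi := Real.pi_gt_three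
      calc |s| * ‖I₀‖ ≤ 2 * Real.pi * |s| * ‖I₀‖ := by
            have : 0 ≤ |s| * ‖I₀‖ := by positivity
            nlinarith
        _ ≤ _ := e2
        _ ≤ C₁ * (|s| ^ M)⁻¹ + (2 * R)⁻¹ * (l + 1) * (C₂ * (|s| ^ M)⁻¹) := by gcongr
        _ = _ := by ring
    calc ‖I₀‖ = |s|⁻¹ * (|s| * ‖I₀‖) := by field_simp
      _ ≤ |s|⁻¹ * ((C₁ + (l + 1) * (2 * R)⁻¹ * C₂) * (|s| ^ M)⁻¹) := by gcongr
      _ = _ := by rw [pow_succ, mul_inv]; ring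

theorem contDiff_comp_sqrt {H : ℝ → ℂ} (hH : ContDiff ℝ (⊤ : ℕ∞) H) (h0 : 0 ∉ tsupport H) :
    ContDiff ℝ (⊤ : ℕ∞) fun x => H (√x) := by
  rw [contDiff_iff_contDiffAt]
  intro x
  rcases eq_or_ne x 0 with rfl | hx
  · have h1 : H =ᶠ[nhds (√(0 : ℝ))] 0 := by
      rw [Real.sqrt_zero]
      exact notMem_tsupport_iff_eventuallyEq.mp h0
    have h2 : (fun x => H (√x)) =ᶠ[nhds (0 : ℝ)] fun _ => 0 :=
      Real.continuous_sqrt.continuousAt.eventually h1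
    exact contDiffAt_const.congr_of_eventuallyEq h2
  · exact hH.contDiffAt.comp x (Real.contDiffAt_sqrt hx)

theorem hasCompactSupport_comp_sqrt {H : ℝ → ℂ} {R : ℝ} (h : ∀ r, R < r → H r = 0)
    (h0 : H 0 = 0) : HasCompactSupport fun x => H (√x) := by
  refine HasCompactSupport.intro (K := Icc 0 (R ^ 2)) isCompact_Icc fun x hx => ?_
  rcases le_or_gt x 0 with hx0 | hx0
  · simp [Real.sqrt_eq_zero_of_nonpos hx0, h0]
  · refine h _ (Real.lt_sqrt_of_sq_lt ?_)
    by_contra hc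
    exact hx ⟨hx0.le, not_lt.mp hc⟩

theorem fourier_comp_sqrt {H : ℝ → ℂ} (h : ∀ r ≤ 0, H r = 0) (τ : ℝ) :
    𝓕 (fun x => H (√x)) τ =
      ∫ r : ℝ, Complex.exp (-(2 * Real.pi * Complex.I * (τ * r ^ 2))) * (2 * r * H r) := by
  rw [Real.fourier_eq']
  have e1 : ∫ v : ℝ, Complex.exp (↑(-2 * Real.pi * ⟪v, τ⟫) * Complex.I) • H (√v) =
      ∫ v in Ioi (0 : ℝ), Complex.exp (↑(-2 * Real.pi * ⟪v, τ⟫) * Complex.I) • H (√v) := by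
    refine (setIntegral_eq_integral_of_forall_compl_eq_zero fun x hx => ?_).symm
    rw [Real.sqrt_eq_zero_of_nonpos (not_lt.mp hx), h 0 le_rfl, smul_zero]
  rw [e1, ← integral_comp_rpow_Ioi_of_pos (p := 2) two_pos]
  rw [← setIntegral_eq_integral_of_forall_compl_eq_zero (s := Ioi (0 : ℝ))
    (f := fun r : ℝ => Complex.exp (-(2 * Real.pi * Complex.I * (τ * r ^ 2))) * (2 * r * H r))]
  · refine setIntegral_congr_fun measurableSet_Ioi fun r hr => ?_
    have hr : 0 < r := hr
    have : √(r ^ 2) = r := Real.sqrt_sq hr.le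
    norm_num [this]
    rw [← mul_assoc, mul_comm (2 * (r : ℂ)), mul_assoc]
    congr 2
    ring
  · intro r hr
    simp [h r (not_lt.mp hr)]

/-- The half-wave symbol `exp (2πisr)` is, for `r` in a compact subset of `(0, ∞)`, a superposition
of the Schrödinger symbols `exp (2πiτr²)`, with a density concentrated on `|τ| ≳ |s|`. -/
theorem exists_schrodinger_superposition (M : ℕ) :
    ∃ C κ : ℝ, 0 ≤ C ∧ 0 < κ ∧ ∀ s : ℝ, s ≠ 0 → ∃ g : 𝓢(ℝ, ℂ),
      (∀ r ∈ Icc (1 / 4 : ℝ) 4, ∫ τ : ℝ, Complex.exp (2 * Real.pi * Complex.I * (τ * r ^ 2)) * g τ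
        = Complex.exp (2 * Real.pi * Complex.I * (s * r))) ∧
      (∀ τ, τ ≠ 0 → ‖g τ‖ ≤ C * |τ| ^ (-(1 / 2) : ℝ)) ∧
      ∀ τ, |τ| ≤ κ * |s| → ‖g τ‖ ≤ C * (|s| ^ M)⁻¹ := by
  let β : ContDiffBump (5 : ℝ) := ⟨19 / 4, 39 / 8, by norm_num, by norm_num⟩
  have hβ1 : ∀ r ∈ Icc (1 / 4 : ℝ) 4, β r = 1 := fun r hr => by
    refine β.one_of_mem_closedBall ?_
    rw [mem_closedBall, Real.dist_eq, abs_le]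
    have : β.rIn = 19 / 4 := rfl
    rw [this]
    exact ⟨by linarith [hr.1], by linarith [hr.2]⟩
  have hβs : tsupport β ⊆ Ioo 0 10 := by
    rw [β.tsupport_eq, Real.closedBall_eq_Icc]
    have : β.rOut = 39 / 8 := rfl
    rw [this]
    intro x hx
    exact ⟨by linarith [hx.1], by linarith [hx.2]⟩
  have hβ0 : ∀ r, r ∉ Ioo (0 : ℝ) 10 → β r = 0 := fun r hr =>
    image_eq_zero_of_notMem_tsupport fun h => hr (hβs h)
  have hβd : ContDiff ℝ (⊤ : ℕ∞) fun r : ℝ => (β r : ℂ) :=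
    Complex.ofRealCLM.contDiff.comp β.contDiff
  have hid : ContDiff ℝ (⊤ : ℕ∞) fun r : ℝ => (r : ℂ) := Complex.ofRealCLM.contDiff
  set b : ℝ → ℂ := fun r => 2 * r * β r with hb
  have hbd : ContDiff ℝ (⊤ : ℕ∞) b := (contDiff_const.mul hid).mul hβd
  have hbβ : tsupport b ⊆ Ioo 0 10 := by
    refine (closure_mono fun r hr => ?_).trans hβs
    simp only [hb, Function.mem_support] at hr ⊢
    intro h
    simp [h] at hr
  have hbc : HasCompactSupport b := HasCompactSupport.intro (K := Icc 0 10) isCompact_Icc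
    fun r hr => by simp [hb, hβ0 r fun h => hr (Ioo_subset_Icc_self h)]
  obtain ⟨C, hC, hns⟩ := exists_norm_integral_nonstationary_le (R := 10) (by norm_num) M 0 b hbd
    (hbβ.trans (Ioo_subset_Ioo (by norm_num) le_rfl))
  set χ : 𝓢(ℝ, ℂ) := hbc.toSchwartzMap hbd
  set C' : ℝ := ∫ y, ‖(𝓕⁻ χ) y‖
  have hC' : 0 ≤ C' := integral_nonneg fun _ => norm_nonneg _
  refine ⟨C + C', 1 / 40, by positivity, by norm_num, fun s hs => ?_⟩
  set H : ℝ → ℂ := fun r => Complex.exp (2 * Real.pi * Complex.I * (s * r)) * β r with hH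
  have hHd : ContDiff ℝ (⊤ : ℕ∞) H :=
    ((contDiff_const.mul (contDiff_const.mul hid)).cexp).mul hβd
  have hHβ : tsupport H ⊆ Ioo 0 10 := by
    refine (closure_mono fun r hr => ?_).trans hβs
    simp only [hH, Function.mem_support] at hr ⊢
    intro h
    simp [h] at hr
  have hH0 : ∀ r, r ∉ Ioo (0 : ℝ) 10 → H r = 0 := fun r hr => by simp [hH, hβ0 r hr]
  let h : 𝓢(ℝ, ℂ) := (hasCompactSupport_comp_sqrt (R := 10)
    (fun r hr => hH0 r fun h => absurd h.2 (not_lt.mpr hr.le))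
    (hH0 0 (by simp))).toSchwartzMap (contDiff_comp_sqrt hHd fun h => absurd (hHβ h).1 (lt_irrefl _))
  have hh : ∀ x, h x = H (√x) := fun x => rfl
  have hF : ∀ τ : ℝ, (𝓕 h) τ = ∫ r : ℝ,
      Complex.exp (2 * Real.pi * Complex.I * (s * r - τ * r ^ 2)) * b r := by
    intro τ
    have : (𝓕 h) τ = 𝓕 (fun x => H (√x)) τ := by rw [fourier_coe]; rfl
    rw [this, fourier_comp_sqrt fun r hr => hH0 r fun h => absurd h.1 (not_lt.mpr hr)]
    refine integral_congr_ae (.of_forall fun r => ?_)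
    simp only [hH, hb]
    rw [mul_sub, sub_eq_add_neg, Complex.exp_add]
    ring
  refine ⟨𝓕 h, fun r hr => ?_, fun τ hτ => ?_, fun τ hτ => ?_⟩
  · have h1 : (𝓕⁻ (𝓕 h)) (r ^ 2) = h (r ^ 2) := by rw [FourierTransform.fourierInv_fourier_eq]
    have hr0 : 0 ≤ r := by linarith [hr.1]
    rw [hh, Real.sqrt_sq hr0, fourierInv_coe, Real.fourierInv_eq'] at h1
    simp only [hH, hβ1 r hr] at h1
    rw [Complex.ofReal_one, mul_one] at h1
    rw [← h1]
    refine integral_congr_ae (.of_forall fun τ => ?_)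
    simp only [smul_eq_mul]
    congr 2
    simp
    ring
  · rw [hF]
    have := norm_integral_schrodinger_le χ s (neg_ne_zero.mpr hτ)
    rw [Module.finrank_self, abs_neg, mul_comm (|τ| ^ _)] at this
    have e : ∫ r : ℝ, Complex.exp (2 * Real.pi * Complex.I * (s * r - τ * r ^ 2)) * b r =
      ∫ ξ : ℝ, Complex.exp (2 * Real.pi * Complex.I * (-τ * ‖ξ‖ ^ 2 + ⟪s, ξ⟫ : ℝ)) * χ ξ := by
      refine integral_congr_ae (.of_forall fun r => ?_)
      have : χ r = b r := rfl
      simp only [this]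
      congr 2
      simp
      ring
    rw [e]
    refine this.trans ?_
    norm_num
    gcongr
    linarith
  · rw [hF]
    have := hns s (τ / s) hs (by
      rw [abs_div, div_mul_eq_mul_div, div_le_one (abs_pos.mpr hs)]
      linarith)
    have e : ∫ r : ℝ, Complex.exp (2 * Real.pi * Complex.I * (s * r - τ * r ^ 2)) * b r =
      ∫ r in (-10)..10, Complex.exp (2 * Real.pi * Complex.I * (s * (r - (τ / s : ℝ) * r ^ 2))) *
        (b r * (1 - 2 * (τ / s : ℝ) * r : ℂ)⁻¹ ^ 0) := by
      rw [intervalIntegral.integral_of_le (by norm_num),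
        ← setIntegral_eq_integral_of_forall_compl_eq_zero (s := Ioc (-10 : ℝ) 10)]
      · refine setIntegral_congr_fun measurableSet_Ioc fun r _ => ?_
        have hs' : (s : ℂ) ≠ 0 := by exact_mod_cast hs
        simp only [pow_zero, mul_one]
        congr 2
        push_cast
        field_simp
      · intro r hr
        have : b r = 0 := by
          simp only [hb]
          rw [hβ0 r fun h => hr ⟨by linarith [h.1], h.2.le⟩]
          simp
        rw [this, mul_zero]
    rw [e]
    refine this.trans ?_
    gcongr
    linarith

theorem integral_le_of_le_const_of_le_rpow {G : ℝ → ℝ} (hG : Integrable G) {a B D q : ℝ}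
    (ha : 0 < a) (hq : 1 < q) (hB : ∀ τ, |τ| ≤ a → G τ ≤ B)
    (hD : ∀ τ, τ ≠ 0 → G τ ≤ D * |τ| ^ (-q)) :
    ∫ τ, G τ ≤ 2 * a * B + 2 * D * (a ^ (1 - q) / (q - 1)) := by
  have key : ∀ F : ℝ → ℝ, Integrable F → (∀ τ, τ ≠ 0 → F τ ≤ D * |τ| ^ (-q)) →
      ∫ τ in Ioi a, F τ ≤ D * (a ^ (1 - q) / (q - 1)) := by
    intro F hF hFD
    have h1 : ∫ τ in Ioi a, D * τ ^ (-q) = D * (a ^ (1 - q) / (q - 1)) := by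
      rw [integral_const_mul, integral_Ioi_rpow_of_lt (by linarith) ha]
      congr 1
      rw [show -q + 1 = -(q - 1) by ring, neg_div_neg_eq, show -(q - 1) = 1 - q by ring]
    rw [← h1]
    refine setIntegral_mono_on hF.integrableOn
      ((integrableOn_Ioi_rpow_of_lt (by linarith) ha).const_mul D) measurableSet_Ioi fun τ hτ => ?_
    have hτ0 : 0 < τ := ha.trans hτ
    simpa [abs_of_pos hτ0] using hFD τ hτ0.ne'
  rw [← intervalIntegral.integral_Iic_add_Ioi (b := -a) hG.integrableOn hG.integrableOn,
    ← Ioc_union_Ioi_eq_Ioi (show -a ≤ a by linarith),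
    setIntegral_union (Ioc_disjoint_Ioi le_rfl) measurableSet_Ioi
      hG.integrableOn hG.integrableOn, ← integral_comp_neg_Ioi]
  have h1 := key G hG hD
  have h2 := key (fun τ => G (-τ)) hG.comp_neg fun τ hτ => by
    simpa using hD (-τ) (neg_ne_zero.mpr hτ)
  have h3 : ∫ τ in Ioc (-a) a, G τ ≤ 2 * a * B := by
    have : ∫ τ in Ioc (-a) a, B = 2 * a * B := by
      simp only [integral_const, MeasurableSet.univ, measureReal_restrict_apply, univ_inter,
        smul_eq_mul, Real.volume_real_Ioc_of_le (show -a ≤ a by linarith)]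
      ring
    rw [← this]
    exact setIntegral_mono_on hG.integrableOn (by simp) measurableSet_Ioc
      fun τ hτ => hB τ (abs_le.mpr ⟨hτ.1.le, hτ.2⟩)
  linarith

theorem norm_cexp_two_pi_I_mul (y : ℝ) : ‖Complex.exp (2 * Real.pi * Complex.I * y)‖ = 1 := by
  have : (2 * Real.pi * Complex.I * y : ℂ) = ((2 * Real.pi * y : ℝ) : ℂ) * Complex.I := by
    push_cast; ring
  rw [this, Complex.norm_exp_ofReal_mul_I]

/-- Dispersive decay of the half-wave kernel at unit frequency. -/
theorem exists_norm_integral_halfWave_le {V : Type*} [NormedAddCommGroup V]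
    [InnerProductSpace ℝ V] [FiniteDimensional ℝ V] [MeasurableSpace V] [BorelSpace V]
    (hn : 2 ≤ Module.finrank ℝ V) (χ : 𝓢(V, ℂ))
    (hχ : ∀ ξ, χ ξ ≠ 0 → ‖ξ‖ ∈ Icc (1 / 4 : ℝ) 4) :
    ∃ C : ℝ, 0 < C ∧ ∀ (s : ℝ) (x : V),
      ‖∫ ξ, Complex.exp (2 * Real.pi * Complex.I * (s * ‖ξ‖ + ⟪x, ξ⟫ : ℝ)) * χ ξ‖ ≤
        C * (1 + |s|) ^ (-(((Module.finrank ℝ V : ℝ) - 1) / 2)) := by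
  set n := Module.finrank ℝ V
  have hn' : (2 : ℝ) ≤ n := by exact_mod_cast hn
  obtain ⟨C, κ, hC, hκ, hsup⟩ := exists_schrodinger_superposition n
  set C₀ : ℝ := ∫ ξ, ‖χ ξ‖
  set C₁ : ℝ := ∫ y, ‖(𝓕⁻ χ) y‖
  have hC₀ : 0 ≤ C₀ := integral_nonneg fun _ => norm_nonneg _
  have hC₁ : 0 ≤ C₁ := integral_nonneg fun _ => norm_nonneg _
  have triv : ∀ θ : V → ℝ,
      ‖∫ ξ, Complex.exp (2 * Real.pi * Complex.I * θ ξ) * χ ξ‖ ≤ C₀ := by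
    intro θ
    refine (norm_integral_le_integral_norm _).trans (le_of_eq ?_)
    simp only [norm_mul, norm_cexp_two_pi_I_mul, one_mul, C₀]
  set e : ℝ := ((n : ℝ) - 1) / 2 with he
  have he0 : 0 < e := by rw [he]; linarith
  set K : ℝ := 2 * κ * (C * C₀) + 2 * (C * C₁) * (κ ^ (-e) / e) with hK
  have hK0 : 0 ≤ K := by positivity
  refine ⟨2 ^ e * (C₀ + K + 1), by positivity, fun s x => ?_⟩
  rcases lt_or_ge |s| 1 with hs1 | hs1
  · refine (triv _).trans ?_
    have : (2 : ℝ) ^ (-e) ≤ (1 + |s|) ^ (-e) :=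
      Real.rpow_le_rpow_of_nonpos (by positivity) (by linarith) (by linarith)
    calc C₀ ≤ C₀ + K + 1 := by linarith
      _ = 2 ^ e * (C₀ + K + 1) * 2 ^ (-e) := by
        rw [Real.rpow_neg two_pos.le]; field_simp
      _ ≤ _ := by gcongr
  have hs0 : 0 < |s| := by linarith
  obtain ⟨g, hg1, hg2, hg3⟩ := hsup s (abs_pos.mp hs0)
  set J : ℝ → ℂ := fun τ =>
    ∫ ξ, Complex.exp (2 * Real.pi * Complex.I * (τ * ‖ξ‖ ^ 2 + ⟪x, ξ⟫ : ℝ)) * χ ξ with hJ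
  have hgc := g.continuous
  have hχc := χ.continuous
  have hprod : Integrable (Function.uncurry fun (ξ : V) (τ : ℝ) =>
      Complex.exp (2 * Real.pi * Complex.I * (τ * ‖ξ‖ ^ 2 + ⟪x, ξ⟫ : ℝ)) * (χ ξ * g τ))
      (volume.prod volume) := by
    refine (χ.integrable.mul_prod g.integrable).mono ?_ (.of_forall fun p => ?_)
    · refine Continuous.aestronglyMeasurable ?_
      simp only [Function.uncurry_def]
      fun_prop
    · simp only [Function.uncurry_def]
      rw [norm_mul, norm_cexp_two_pi_I_mul, one_mul]
  have hI : ∫ ξ, Complex.exp (2 * Real.pi * Complex.I * (s * ‖ξ‖ + ⟪x, ξ⟫ : ℝ)) * χ ξ =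
      ∫ τ, g τ * J τ := by
    have h1 : ∀ τ, g τ * J τ = ∫ ξ, Complex.exp (2 * Real.pi * Complex.I *
        (τ * ‖ξ‖ ^ 2 + ⟪x, ξ⟫ : ℝ)) * (χ ξ * g τ) := by
      intro τ
      rw [hJ, ← integral_const_mul]
      refine integral_congr_ae (.of_forall fun ξ => ?_)
      simp only; ring
    simp only [h1]
    rw [← integral_integral_swap hprod]
    refine integral_congr_ae (.of_forall fun ξ => ?_)
    simp only
    by_cases hξ : χ ξ = 0
    · simp [hξ]
    have h2 : ∫ τ, Complex.exp (2 * Real.pi * Complex.I *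
        (τ * ‖ξ‖ ^ 2 + ⟪x, ξ⟫ : ℝ)) * (χ ξ * g τ) =
        Complex.exp (2 * Real.pi * Complex.I * ⟪x, ξ⟫) * χ ξ *
        ∫ τ : ℝ, Complex.exp (2 * Real.pi * Complex.I * (τ * ‖ξ‖ ^ 2)) * g τ := by
      rw [← integral_const_mul]
      refine integral_congr_ae (.of_forall fun τ => ?_)
      simp only
      push_cast
      rw [mul_add, Complex.exp_add]
      ring
    have h3 := hg1 ‖ξ‖ (hχ ξ hξ)
    rw [h2, h3]
    push_cast
    rw [mul_add, Complex.exp_add]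
    ring
  have hGi : Integrable fun τ => g τ * J τ := by
    refine hprod.integral_prod_right.congr (.of_forall fun τ => ?_)
    simp only [Function.uncurry_def, hJ]
    rw [← integral_const_mul]
    refine integral_congr_ae (.of_forall fun ξ => ?_)
    simp only; ring
  have hbound := integral_le_of_le_const_of_le_rpow hGi.norm (a := κ * |s|)
    (B := C * (|s| ^ n)⁻¹ * C₀) (D := C * C₁) (q := e + 1) (by positivity) (by linarith)
    (fun τ hτ => by
      rw [norm_mul]
      exact mul_le_mul (hg3 τ hτ) (triv _) (norm_nonneg _) (by positivity))
    (fun τ hτ => by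
      rw [norm_mul]
      refine (mul_le_mul (hg2 τ hτ) (norm_integral_schrodinger_le χ x hτ) (norm_nonneg _)
        (by positivity)).trans (le_of_eq ?_)
      have : -(e + 1) = -(1 / 2) + -((n : ℝ) / 2) := by rw [he]; ring
      rw [this, Real.rpow_add (abs_pos.mpr hτ)]
      ring)
  have hpow : |s| * (|s| ^ n)⁻¹ ≤ |s| ^ (-e) := by
    rw [← Real.rpow_natCast, ← Real.rpow_neg hs0.le, ← Real.rpow_one_add' hs0.le (by linarith)]
    refine Real.rpow_le_rpow_of_exponent_le hs1 ?_
    rw [he]; linarith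
  have h4 : ∫ τ, ‖g τ * J τ‖ ≤ K * |s| ^ (-e) := by
    refine hbound.trans ?_
    rw [show 1 - (e + 1) = -e by ring, show e + 1 - 1 = e by ring,
      Real.mul_rpow hκ.le hs0.le]
    calc _ = 2 * κ * (C * C₀) * (|s| * (|s| ^ n)⁻¹)
          + 2 * (C * C₁) * (κ ^ (-e) / e) * |s| ^ (-e) := by ring
      _ ≤ 2 * κ * (C * C₀) * |s| ^ (-e) + 2 * (C * C₁) * (κ ^ (-e) / e) * |s| ^ (-e) := by
          gcongr
      _ = _ := by rw [hK]; ring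
  have h5 : |s| ^ (-e) ≤ 2 ^ e * (1 + |s|) ^ (-e) := by
    have : (2 * |s|) ^ (-e) ≤ (1 + |s|) ^ (-e) :=
      Real.rpow_le_rpow_of_nonpos (by positivity) (by linarith) (by linarith)
    rw [Real.mul_rpow two_pos.le hs0.le] at this
    calc |s| ^ (-e) = 2 ^ e * (2 ^ (-e) * |s| ^ (-e)) := by
          rw [Real.rpow_neg two_pos.le]; field_simp
      _ ≤ _ := by gcongr
  rw [hI]
  calc ‖∫ τ, g τ * J τ‖ ≤ K * |s| ^ (-e) := (norm_integral_le_integral_norm _).trans h4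
    _ ≤ (C₀ + K + 1) * (2 ^ e * (1 + |s|) ^ (-e)) := by gcongr; linarith
    _ = _ := by ring

/-- Smooth splitting of a Schwartz function at height `h`. -/
theorem exists_schwartz_truncation {V : Type*} [NormedAddCommGroup V]
    [InnerProductSpace ℝ V] [FiniteDimensional ℝ V] (g : 𝓢(V, ℂ)) {h : ℝ} (hh : 0 < h) :
    ∃ g₁ g₂ : 𝓢(V, ℂ), g = g₁ + g₂ ∧
      (∀ x, ‖g₁ x‖ ≤ ‖g x‖ ∧ (‖g x‖ < h → g₁ x = 0)) ∧
      ∀ x, ‖g₂ x‖ ≤ ‖g x‖ ∧ (2 * h < ‖g x‖ → g₂ x = 0) := by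
  set η : V → ℝ := fun x => Real.smoothTransition ((‖g x‖ ^ 2 / h ^ 2 - 1) / 3) with hη
  have hgd : ContDiff ℝ (⊤ : ℕ∞) g := g.smooth ⊤
  have hηd : ContDiff ℝ (⊤ : ℕ∞) η :=
    Real.smoothTransition.contDiff.comp
      ((((hgd.norm_sq ℝ).div_const _).sub contDiff_const).div_const _)
  have hη0 : ∀ x, ‖g x‖ < h → η x = 0 := fun x hx => by
    refine Real.smoothTransition.zero_of_nonpos ?_
    have : ‖g x‖ ^ 2 / h ^ 2 ≤ 1 := by
      rw [div_le_one (by positivity)]; gcongr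
    linarith
  have hη1 : ∀ x, 2 * h < ‖g x‖ → η x = 1 := fun x hx => by
    refine Real.smoothTransition.one_of_one_le ?_
    have : 4 ≤ ‖g x‖ ^ 2 / h ^ 2 := by
      rw [le_div_iff₀ (by positivity)]; nlinarith
    linarith
  have hηn : ∀ x, 0 ≤ η x := fun x => Real.smoothTransition.nonneg _
  have hηl : ∀ x, η x ≤ 1 := fun x => Real.smoothTransition.le_one _
  have hd : ContDiff ℝ (⊤ : ℕ∞) fun x => (η x : ℂ) * g x :=
    (Complex.ofRealCLM.contDiff.comp hηd).mul hgd
  have hcs : HasCompactSupport fun x => (η x : ℂ) * g x := by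
    have h1 : ∀ᶠ x in Filter.cocompact V, ‖g x‖ < h := by
      have := (g.tendsto_cocompact).norm
      rw [norm_zero] at this
      exact this.eventually_lt_const hh
    obtain ⟨K, hK, hKs⟩ := Filter.mem_cocompact.mp h1
    exact HasCompactSupport.intro hK fun x hx => by simp [hη0 x (hKs hx)]
  refine ⟨hcs.toSchwartzMap hd, g - hcs.toSchwartzMap hd, by abel, fun x => ⟨?_, fun hx => ?_⟩,
    fun x => ⟨?_, fun hx => ?_⟩⟩
  · change ‖(η x : ℂ) * g x‖ ≤ _
    rw [norm_mul, Complex.norm_real, Real.norm_eq_abs, abs_of_nonneg (hηn x)]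
    exact mul_le_of_le_one_left (norm_nonneg _) (hηl x)
  · change (η x : ℂ) * g x = 0
    simp [hη0 x hx]
  · change ‖g x - (η x : ℂ) * g x‖ ≤ _
    have : g x - (η x : ℂ) * g x = ((1 - η x : ℝ) : ℂ) * g x := by push_cast; ring
    rw [this, norm_mul, Complex.norm_real, Real.norm_eq_abs,
      abs_of_nonneg (sub_nonneg.mpr (hηl x))]
    exact mul_le_of_le_one_left (norm_nonneg _) (by linarith [hηn x])
  · change g x - (η x : ℂ) * g x = 0
    simp [hη1 x hx]

section Multiplier

variable {V : Type*} [NormedAddCommGroup V] [InnerProductSpace ℝ V] [FiniteDimensional ℝ V]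
  [MeasurableSpace V] [BorelSpace V]

theorem norm_fourierMultiplierCLM_apply_le {m : V → ℂ} (hm : HasCompactSupport m)
    (hmd : ContDiff ℝ (⊤ : ℕ∞) m) {A : ℝ}
    (hA : ∀ x, ‖∫ ξ, Complex.exp (2 * Real.pi * Complex.I * ⟪x, ξ⟫) * m ξ‖ ≤ A)
    (g : 𝓢(V, ℂ)) (x : V) :
    ‖fourierMultiplierCLM ℂ m g x‖ ≤ A * ∫ y, ‖g y‖ := by
  have hmc := hmd.continuous
  have hmi : Integrable m := hmc.integrable_of_hasCompactSupport hm
  set h : V → ℂ := fun ξ => Complex.exp (2 * Real.pi * Complex.I * ⟪x, ξ⟫) * m ξ with hh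
  have hhi : Integrable h := by
    refine hmi.mono (Continuous.aestronglyMeasurable (by fun_prop)) (.of_forall fun ξ => ?_)
    simp only [hh]
    rw [norm_mul, norm_cexp_two_pi_I_mul, one_mul]
  have e1 : fourierMultiplierCLM ℂ m g x = ∫ y, g y * 𝓕 h y := by
    rw [← integral_mul_fourier_eq g.integrable hhi, fourierMultiplierCLM_apply, fourierInv_coe,
      Real.fourierInv_eq']
    refine integral_congr_ae (.of_forall fun ξ => ?_)
    simp only
    rw [smulLeftCLM_apply_apply (hm.hasTemperateGrowth hmd), fourier_coe]
    simp only [hh, smul_eq_mul]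
    rw [real_inner_comm]
    push_cast
    ring_nf
  have e2 : ∀ y, ‖𝓕 h y‖ ≤ A := by
    intro y
    refine le_trans (le_of_eq ?_) (hA (x - y))
    rw [Real.fourier_eq']
    congr 1
    refine integral_congr_ae (.of_forall fun ξ => ?_)
    simp only [hh, smul_eq_mul]
    rw [← mul_assoc, ← Complex.exp_add]
    congr 2
    rw [inner_sub_left, real_inner_comm y ξ]
    push_cast
    ring
  rw [e1, ← integral_const_mul]
  refine (norm_integral_le_integral_norm _).trans ?_
  refine integral_mono_of_nonneg (.of_forall fun _ => norm_nonneg _) (g.integrable.norm.const_mul _)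
    (.of_forall fun y => ?_)
  simp only [norm_mul]
  rw [mul_comm]
  exact mul_le_mul_of_nonneg_right (e2 y) (norm_nonneg _)

theorem integrable_norm_sq (g : 𝓢(V, ℂ)) : Integrable fun x => ‖g x‖ ^ 2 :=
  (memLp_two_iff_integrable_sq_norm g.continuous.aestronglyMeasurable).mp (g.memLp 2 volume)

theorem integral_norm_sq_fourierMultiplierCLM_le {m : V → ℂ} (hm : HasCompactSupport m)
    (hmd : ContDiff ℝ (⊤ : ℕ∞) m) (h1 : ∀ ξ, ‖m ξ‖ ≤ 1) (g : 𝓢(V, ℂ)) :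
    ∫ x, ‖fourierMultiplierCLM ℂ m g x‖ ^ 2 ≤ ∫ x, ‖g x‖ ^ 2 := by
  rw [← integral_norm_sq_fourier, ← integral_norm_sq_fourier g, fourierMultiplierCLM_apply,
    FourierTransform.fourier_fourierInv_eq]
  refine integral_mono (integrable_norm_sq _) (integrable_norm_sq _) fun ξ => ?_
  simp only
  rw [smulLeftCLM_apply_apply (hm.hasTemperateGrowth hmd), norm_smul]
  gcongr
  exact mul_le_of_le_one_left (norm_nonneg _) (h1 ξ)

end Multiplier

section Interpolation

variable {V : Type*} [NormedAddCommGroup V] [InnerProductSpace ℝ V] [FiniteDimensional ℝ V]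
  [MeasurableSpace V] [BorelSpace V]

theorem integrable_norm_rpow_schwartz (g : 𝓢(V, ℂ)) {q : ℝ} (hq : 1 ≤ q) :
    Integrable fun x => ‖g x‖ ^ q := by
  have := (g.memLp (ENNReal.ofReal q) volume).integrable_norm_rpow
    (by simp; linarith) ENNReal.ofReal_ne_top
  rwa [ENNReal.toReal_ofReal (by linarith)] at this

set_option maxHeartbeats 1000000 in
/-- Distributional bound for `T g` from the endpoint bounds, by truncating `g` at a height adapted to `t`. -/
theorem measure_lt_norm_le {T : 𝓢(V, ℂ) →ₗ[ℂ] 𝓢(V, ℂ)} {A : ℝ} (hA : 0 < A)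
    (h1 : ∀ g x, ‖T g x‖ ≤ A * ∫ y, ‖g y‖)
    (h2 : ∀ g, ∫ x, ‖T g x‖ ^ 2 ≤ ∫ x, ‖g x‖ ^ 2) {p q : ℝ} (hpq : p.HolderConjugate q)
    (g : 𝓢(V, ℂ)) (hG : 0 < ∫ x, ‖g x‖ ^ q) {t : ℝ} (ht : 0 < t) :
    volume {x | t < ‖T g x‖} ≤ ENNReal.ofReal (4 / t ^ 2) *
      ∫⁻ x, {x | ‖g x‖ ≤ 2 * (2 * A * (∫ x, ‖g x‖ ^ q) / t) ^ (p - 1)}.indicator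
        (fun x => ENNReal.ofReal (‖g x‖ ^ 2)) x := by
  set G := ∫ x, ‖g x‖ ^ q
  set h : ℝ := (2 * A * G / t) ^ (p - 1) with hh
  have hh0 : 0 < h := by positivity
  obtain ⟨g₁, g₂, hg, hg1, hg2⟩ := exists_schwartz_truncation g hh0
  have hq1 : 1 < q := hpq.symm.lt
  have e1 : ∀ x, ‖T g₁ x‖ ≤ t / 2 := by
    intro x
    have b1 : ∫ y, ‖g₁ y‖ ≤ h ^ (1 - q) * G := by
      rw [← integral_const_mul]
      refine integral_mono g₁.integrable.norm
        ((integrable_norm_rpow_schwartz g hq1.le).const_mul _) fun y => ?_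
      simp only
      rcases lt_or_ge ‖g y‖ h with hy | hy
      · rw [(hg1 y).2 hy, norm_zero]; positivity
      · have hgy : 0 < ‖g y‖ := hh0.trans_le hy
        calc ‖g₁ y‖ ≤ ‖g y‖ := (hg1 y).1
          _ = ‖g y‖ ^ (1 - q) * ‖g y‖ ^ q := by
            rw [← Real.rpow_add hgy]; simp
          _ ≤ _ := by
            exact mul_le_mul_of_nonneg_right
              (Real.rpow_le_rpow_of_nonpos hh0 hy (by linarith)) (by positivity)
    have b2 : h ^ (1 - q) = t / (2 * A * G) := by
      have : (p - 1) * (1 - q) = -1 := by linarith [hpq.sub_one_mul_conj, hpq.mul_eq_add]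
      rw [hh, ← Real.rpow_mul (by positivity), this, Real.rpow_neg_one, inv_div]
    calc ‖T g₁ x‖ ≤ A * ∫ y, ‖g₁ y‖ := h1 _ _
      _ ≤ A * (h ^ (1 - q) * G) := by gcongr
      _ = t / 2 := by rw [b2]; field_simp
  have e2 : {x | t < ‖T g x‖} ⊆ {x | ENNReal.ofReal ((t / 2) ^ 2) ≤
      ENNReal.ofReal (‖T g₂ x‖ ^ 2)} := by
    intro x hx
    have hx : t < ‖T g x‖ := hx
    have : T g x = T g₁ x + T g₂ x := by
      conv_lhs => rw [hg, map_add]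
      rfl
    rw [this] at hx
    have := hx.trans_le (norm_add_le _ _)
    have := e1 x
    refine ENNReal.ofReal_le_ofReal ?_
    gcongr
    linarith
  have e3 := mul_meas_ge_le_lintegral₀ (μ := volume)
    (f := fun x => ENNReal.ofReal (‖T g₂ x‖ ^ 2))
    ((T g₂).continuous.norm.pow 2).measurable.ennreal_ofReal.aemeasurable
    (ENNReal.ofReal ((t / 2) ^ 2))
  have e4 : ∫⁻ x, ENNReal.ofReal (‖T g₂ x‖ ^ 2) ≤
      ∫⁻ x, {x | ‖g x‖ ≤ 2 * h}.indicator (fun x => ENNReal.ofReal (‖g x‖ ^ 2)) x := by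
    rw [← ofReal_integral_eq_lintegral_ofReal (integrable_norm_sq _)
      (.of_forall fun _ => by positivity)]
    refine (ENNReal.ofReal_le_ofReal (h2 g₂)).trans ?_
    rw [ofReal_integral_eq_lintegral_ofReal (integrable_norm_sq _)
      (.of_forall fun _ => by positivity)]
    refine lintegral_mono fun x => ?_
    by_cases hx : ‖g x‖ ≤ 2 * h
    · rw [indicator_of_mem (by exact hx)]
      refine ENNReal.ofReal_le_ofReal ?_
      gcongr
      exact (hg2 x).1
    · simp [(hg2 x).2 (not_le.mp hx)]
  have e5 : ENNReal.ofReal (4 / t ^ 2) * ENNReal.ofReal ((t / 2) ^ 2) = 1 := by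
    rw [← ENNReal.ofReal_mul (by positivity)]
    have : 4 / t ^ 2 * (t / 2) ^ 2 = 1 := by field_simp; norm_num
    rw [this, ENNReal.ofReal_one]
  calc volume {x | t < ‖T g x‖}
      = ENNReal.ofReal (4 / t ^ 2) * (ENNReal.ofReal ((t / 2) ^ 2) *
          volume {x | t < ‖T g x‖}) := by rw [← mul_assoc, e5, one_mul]
    _ ≤ _ := by
      gcongr
      refine le_trans ?_ (e3.trans e4)
      gcongr

theorem lintegral_level_le {p a c : ℝ} (hp : 2 < p) (ha : 0 < a) (hc : 0 ≤ c) :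
    ∫⁻ t in Ioi (0 : ℝ), ENNReal.ofReal (4 / t ^ 2) *
      ({t : ℝ | c ≤ 2 * (a / t) ^ (p - 1)}.indicator (fun _ => ENNReal.ofReal (c ^ 2)) t) *
        ENNReal.ofReal (t ^ (p - 1)) ≤
      ENNReal.ofReal (4 / (p - 2) * 2 ^ ((p - 2) / (p - 1)) * a ^ (p - 2) * c ^ (p / (p - 1))) := by
  rcases hc.eq_or_lt with rfl | hc
  · simp
  set L : ℝ := a * (2 / c) ^ (1 / (p - 1)) with hL
  have hL0 : 0 < L := by positivity
  have hp1 : 0 < p - 1 := by linarith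
  calc _ ≤ ∫⁻ t in Ioi (0 : ℝ), (Ioc 0 L).indicator
        (fun t => ENNReal.ofReal (4 * c ^ 2 * t ^ (p - 3))) t := by
        refine setLIntegral_mono' measurableSet_Ioi fun t ht => ?_
        have ht : 0 < t := ht
        by_cases h : c ≤ 2 * (a / t) ^ (p - 1)
        · have htL : t ≤ L := by
            have h1 : (c / 2) ^ (1 / (p - 1)) ≤ a / t := by
              have : c / 2 ≤ (a / t) ^ (p - 1) := by linarith
              calc _ ≤ ((a / t) ^ (p - 1)) ^ (1 / (p - 1)) := by gcongr
                _ = a / t := by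
                  rw [← Real.rpow_mul (by positivity), mul_one_div_cancel hp1.ne', Real.rpow_one]
            have h2 : (2 / c) ^ (1 / (p - 1)) * (c / 2) ^ (1 / (p - 1)) = 1 := by
              rw [← Real.mul_rpow (by positivity) (by positivity)]
              have : 2 / c * (c / 2) = 1 := by field_simp
              rw [this, Real.one_rpow]
            rw [le_div_iff₀ ht] at h1
            calc t = (2 / c) ^ (1 / (p - 1)) * ((c / 2) ^ (1 / (p - 1)) * t) := by
                  rw [← mul_assoc, h2, one_mul]
              _ ≤ (2 / c) ^ (1 / (p - 1)) * a := by gcongr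
              _ = L := by rw [hL, mul_comm]
          rw [indicator_of_mem (by exact h), indicator_of_mem (show t ∈ Ioc 0 L from ⟨ht, htL⟩),
            ← ENNReal.ofReal_mul (by positivity), ← ENNReal.ofReal_mul (by positivity)]
          refine ENNReal.ofReal_le_ofReal (le_of_eq ?_)
          have : t ^ (p - 1) = t ^ (p - 3) * t ^ 2 := by
            rw [← Real.rpow_natCast t 2, ← Real.rpow_add ht]
            congr 1
            push_cast; ring
          rw [this]
          field_simp
        · rw [indicator_of_notMem (by exact h)]
          simp
    _ = ∫⁻ t in Ioc 0 L, ENNReal.ofReal (4 * c ^ 2 * t ^ (p - 3)) := by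
        rw [lintegral_indicator measurableSet_Ioc, Measure.restrict_restrict measurableSet_Ioc,
          inter_eq_left.mpr Ioc_subset_Ioi_self]
    _ = ENNReal.ofReal (∫ t in Ioc 0 L, 4 * c ^ 2 * t ^ (p - 3)) := by
        refine (ofReal_integral_eq_lintegral_ofReal ?_ ?_).symm
        · exact ((intervalIntegral.intervalIntegrable_rpow' (a := 0) (b := L)
            (show -1 < p - 3 by linarith)).1).const_mul _
        · filter_upwards [ae_restrict_mem measurableSet_Ioc] with t ht
          have := ht.1
          simp only [Pi.zero_apply]
          positivity
    _ = _ := by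
        congr 1
        rw [integral_const_mul, ← intervalIntegral.integral_of_le hL0.le,
          integral_rpow (Or.inl (by linarith)), Real.zero_rpow (by linarith),
          show p - 3 + 1 = p - 2 by ring, hL, Real.mul_rpow ha.le (by positivity),
          ← Real.rpow_mul (by positivity), show 1 / (p - 1) * (p - 2) = (p - 2) / (p - 1) by ring,
          Real.div_rpow two_pos.le hc.le]
        have : c ^ 2 = c ^ ((p - 2) / (p - 1)) * c ^ (p / (p - 1)) := by
          rw [← Real.rpow_natCast c 2, ← Real.rpow_add hc]
          congr 1
          push_cast
          field_simp
          ring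
        rw [this]
        have h3 : c ^ ((p - 2) / (p - 1)) ≠ 0 := by positivity
        field_simp
        ring

/-- Off-diagonal real interpolation between `L¹ → L^∞` and `L² → L²`. -/
theorem lintegral_norm_rpow_le {T : 𝓢(V, ℂ) →ₗ[ℂ] 𝓢(V, ℂ)} {A : ℝ} (hA : 0 < A)
    (h1 : ∀ g x, ‖T g x‖ ≤ A * ∫ y, ‖g y‖)
    (h2 : ∀ g, ∫ x, ‖T g x‖ ^ 2 ≤ ∫ x, ‖g x‖ ^ 2) {p q : ℝ} (hp : 2 < p)
    (hpq : p.HolderConjugate q) (g : 𝓢(V, ℂ)) (hG : 0 < ∫ x, ‖g x‖ ^ q) :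
    ∫⁻ x, ENNReal.ofReal (‖T g x‖ ^ p) ≤
      ENNReal.ofReal (p * (4 / (p - 2) * 2 ^ ((p - 2) / (p - 1)) * 2 ^ (p - 2)) * A ^ (p - 2) *
        (∫ x, ‖g x‖ ^ q) ^ (p - 1)) := by
  set G := ∫ x, ‖g x‖ ^ q with hGdef
  have hgc := g.continuous
  have hTc := (T g).continuous
  have hp0 : 0 < p := by linarith
  rw [lintegral_rpow_eq_lintegral_meas_lt_mul volume (.of_forall fun _ => norm_nonneg _)
    hTc.norm.aemeasurable hp0]
  set S : ℝ → V → ℝ≥0∞ := fun t x => ENNReal.ofReal (4 / t ^ 2) *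
    ({x | ‖g x‖ ≤ 2 * (2 * A * G / t) ^ (p - 1)}.indicator
        (fun x => ENNReal.ofReal (‖g x‖ ^ 2)) x) * ENNReal.ofReal (t ^ (p - 1)) with hS
  have hSm : Measurable (Function.uncurry S) := by
    have hm : MeasurableSet {z : ℝ × V | ‖g z.2‖ ≤ 2 * (2 * A * G / z.1) ^ (p - 1)} :=
      measurableSet_le (by fun_prop) (by fun_prop)
    have : Measurable ({z : ℝ × V | ‖g z.2‖ ≤ 2 * (2 * A * G / z.1) ^ (p - 1)}.indicator
        (fun z => ENNReal.ofReal (‖g z.2‖ ^ 2))) := Measurable.indicator (by fun_prop) hm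
    exact ((show Measurable fun z : ℝ × V => ENNReal.ofReal (4 / z.1 ^ 2) by fun_prop).mul
      this).mul (by fun_prop)
  have s1 : ∫⁻ t in Ioi (0 : ℝ), volume {x | t < ‖T g x‖} * ENNReal.ofReal (t ^ (p - 1)) ≤
      ∫⁻ t in Ioi (0 : ℝ), ∫⁻ x, S t x := by
    refine setLIntegral_mono' measurableSet_Ioi fun t ht => ?_
    refine (mul_le_mul_left (measure_lt_norm_le hA h1 h2 hpq g hG ht) _).trans (le_of_eq ?_)
    have hm : Measurable ({x | ‖g x‖ ≤ 2 * (2 * A * G / t) ^ (p - 1)}.indicator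
        (fun x => ENNReal.ofReal (‖g x‖ ^ 2))) :=
      Measurable.indicator (by fun_prop) (measurableSet_le (by fun_prop) (by fun_prop))
    simp only [hS]
    rw [lintegral_mul_const _ (hm.const_mul _), lintegral_const_mul _ hm]
  have s2 : ∫⁻ t in Ioi (0 : ℝ), ∫⁻ x, S t x ≤ ∫⁻ x, ENNReal.ofReal
      (4 / (p - 2) * 2 ^ ((p - 2) / (p - 1)) * (2 * A * G) ^ (p - 2) * ‖g x‖ ^ q) := by
    rw [lintegral_lintegral_swap hSm.aemeasurable]
    refine lintegral_mono fun x => ?_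
    rw [hpq.conjugate_eq]
    exact lintegral_level_le hp (by positivity) (norm_nonneg _)
  refine (mul_le_mul_right (s1.trans s2) _).trans (le_of_eq ?_)
  rw [← ofReal_integral_eq_lintegral_ofReal
    ((integrable_norm_rpow_schwartz g hpq.symm.lt.le).const_mul _)
    (.of_forall fun _ => by have := sub_pos.mpr hp; positivity), integral_const_mul,
    ← ENNReal.ofReal_mul hp0.le, ← hGdef]
  congr 1
  have : G ^ (p - 1) = G ^ (p - 2) * G := by
    rw [← Real.rpow_add_one hG.ne']; congr 1; ring
  rw [this, Real.mul_rpow (by positivity) hG.le, Real.mul_rpow two_pos.le hA.le]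
  ring

/-- Interpolation of `L¹ → L^∞` and `L² → L²` bounds on Schwartz functions, in `L^{p'} → L^p` form. -/
theorem exists_eLpNorm_le_of_endpoints (p : ℝ≥0∞) (hp : 2 ≤ p) :
    ∃ c : ℝ, 0 ≤ c ∧ ∀ (T : 𝓢(V, ℂ) →ₗ[ℂ] 𝓢(V, ℂ)) (A : ℝ), 0 < A →
      (∀ g x, ‖T g x‖ ≤ A * ∫ y, ‖g y‖) → (∀ g, ∫ x, ‖T g x‖ ^ 2 ≤ ∫ x, ‖g x‖ ^ 2) →
      ∀ g, eLpNorm (T g) p volume ≤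
        ENNReal.ofReal (c * A ^ (1 - 2 * (p⁻¹).toReal)) * eLpNorm g (1 - 1 / p)⁻¹ volume := by
  have hnorm : ∀ (f : 𝓢(V, ℂ)) (r : ℝ), 1 ≤ r →
      eLpNorm f (ENNReal.ofReal r) volume = ENNReal.ofReal ((∫ x, ‖f x‖ ^ r) ^ (1 / r)) := by
    intro f r hr
    rw [(f.memLp _ volume).eLpNorm_eq_integral_rpow_norm (by simp; linarith) ENNReal.ofReal_ne_top,
      ENNReal.toReal_ofReal (by linarith), one_div]
  rcases eq_or_ne p ∞ with rfl | hpt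
  · refine ⟨1, zero_le_one, fun T A hA h1 h2 g => ?_⟩
    have h := hnorm g 1 le_rfl
    simp only [ENNReal.ofReal_one, Real.rpow_one, div_one] at h
    simp only [ENNReal.inv_top, ENNReal.toReal_zero, mul_zero, sub_zero, Real.rpow_one, one_mul,
      div_eq_mul_inv, tsub_zero, inv_one, h]
    rw [← ENNReal.ofReal_mul hA.le, eLpNorm_exponent_top]
    refine eLpNormEssSup_le_of_ae_bound (.of_forall (h1 g))
  lift p to ℝ≥0 using hpt
  have hp' : (2 : ℝ) ≤ p := by exact_mod_cast hp
  have hp0 : (0 : ℝ) < p := by linarith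
  have hpp : (p : ℝ≥0∞) = ENNReal.ofReal p := by simp
  have hinv : (p : ℝ≥0∞)⁻¹.toReal = (p : ℝ)⁻¹ := by simp
  set q : ℝ := Real.conjExponent p with hqdef
  have hpq : (p : ℝ).HolderConjugate q := Real.HolderConjugate.conjExponent (by linarith)
  have hq1 : 1 < q := hpq.symm.lt
  have hqq : (1 - 1 / (p : ℝ≥0∞))⁻¹ = ENNReal.ofReal q := by
    rw [hpp, ← ENNReal.ofReal_one, ← ENNReal.ofReal_div_of_pos hp0,
      ← ENNReal.ofReal_sub _ (by positivity), ← ENNReal.ofReal_inv_of_pos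
        (by rw [sub_pos, div_lt_one hp0]; linarith)]
    congr 1
    rw [one_div, hpq.one_sub_inv, inv_inv]
  rw [hqq, hpp]
  rcases hp'.eq_or_lt with hp2 | hp2
  · refine ⟨1, zero_le_one, fun T A hA h1 h2 g => ?_⟩
    have hq2 : q = 2 := by rw [hqdef, ← hp2, Real.conjExponent]; norm_num
    rw [hnorm _ _ (by linarith), hnorm _ _ hq1.le, hq2, ← hpp, hinv, ← hp2]
    norm_num
    refine ENNReal.ofReal_le_ofReal ?_
    have := h2 g
    gcongr
  · have := sub_pos.mpr hp2
    set k : ℝ := p * (4 / (p - 2) * 2 ^ (((p : ℝ) - 2) / (p - 1)) * 2 ^ ((p : ℝ) - 2)) with hk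
    have hp1 : 0 < (p : ℝ) - 1 := by linarith
    have hk0 : 0 ≤ k := by positivity
    refine ⟨k ^ (1 / (p : ℝ)), by positivity, fun T A hA h1 h2 g => ?_⟩
    rw [hnorm _ _ (by linarith), hnorm _ _ hq1.le, ← hpp, hinv,
      ← ENNReal.ofReal_mul (by positivity)]
    refine ENNReal.ofReal_le_ofReal ?_
    have hG0 : 0 ≤ ∫ x, ‖g x‖ ^ q := integral_nonneg fun _ => by positivity
    rcases hG0.eq_or_lt with hG | hG
    · have hg : ∀ᵐ x, ‖g x‖ ^ q = 0 :=
        (integral_eq_zero_iff_of_nonneg (fun _ => by positivity)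
          (integrable_norm_rpow_schwartz g hq1.le)).mp hG.symm
      have hg1 : ∫ y, ‖g y‖ = 0 := by
        rw [← integral_zero V ℝ]
        refine integral_congr_ae (hg.mono fun x hx => ?_)
        exact (Real.rpow_eq_zero (norm_nonneg _) (by linarith)).mp hx
      have hT : ∀ x, ‖T g x‖ = 0 := fun x =>
        le_antisymm ((h1 g x).trans (by simp [hg1])) (norm_nonneg _)
      simp only [hT]
      rw [Real.zero_rpow hp0.ne', integral_zero, Real.zero_rpow (by positivity)]
      positivity
    · have h3 := lintegral_norm_rpow_le hA h1 h2 hp2 hpq g hG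
      rw [← ofReal_integral_eq_lintegral_ofReal (integrable_norm_rpow_schwartz _ (by linarith))
        (.of_forall fun _ => by positivity), ENNReal.ofReal_le_ofReal_iff (by positivity)] at h3
      have h4 := Real.rpow_le_rpow (integral_nonneg fun _ => by positivity) h3
        (show 0 ≤ 1 / (p : ℝ) by positivity)
      refine h4.trans (le_of_eq ?_)
      rw [Real.mul_rpow (by positivity) (by positivity), Real.mul_rpow hk0 (by positivity),
        ← Real.rpow_mul hA.le, ← Real.rpow_mul hG.le]
      have e1 : ((p : ℝ) - 2) * (1 / p) = 1 - 2 * (p : ℝ)⁻¹ := by field_simp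
      have e2 : ((p : ℝ) - 1) * (1 / p) = 1 / q := by
        rw [one_div q, ← hpq.one_sub_inv]; field_simp
      rw [e1, e2]

end Interpolation

section HalfWaveSymbol

variable {V : Type*} [NormedAddCommGroup V] [InnerProductSpace ℝ V]

/-- The half-wave symbol `e^{2πis|ξ|}` cut off to frequencies `|ξ| ∼ N` by `χ(ξ/N)`. -/
def halfWaveSymbol (χ : 𝓢(V, ℂ)) (s N : ℝ) (ξ : V) : ℂ :=
  Complex.exp (2 * Real.pi * Complex.I * (s * ‖ξ‖ : ℝ)) * χ (N⁻¹ • ξ)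

theorem norm_halfWaveSymbol (χ : 𝓢(V, ℂ)) (s N : ℝ) (ξ : V) :
    ‖halfWaveSymbol χ s N ξ‖ = ‖χ (N⁻¹ • ξ)‖ := by
  rw [halfWaveSymbol, norm_mul, norm_cexp_two_pi_I_mul, one_mul]

variable {χ : 𝓢(V, ℂ)} {N : ℝ}

theorem halfWaveSymbol_eq_zero (hχ : ∀ ξ, χ ξ ≠ 0 → ‖ξ‖ ∈ Icc (1 / 4 : ℝ) 4) (hN : 0 < N)
    {s : ℝ} {ξ : V} (hξ : ‖ξ‖ ∉ Icc (N / 4) (4 * N)) : halfWaveSymbol χ s N ξ = 0 := by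
  by_contra h
  have := hχ _ (right_ne_zero_of_mul h)
  rw [norm_smul, norm_inv, Real.norm_of_nonneg hN.le, inv_mul_eq_div, mem_Icc,
    le_div_iff₀ hN, div_le_iff₀ hN] at this
  exact hξ ⟨by linarith, by linarith⟩

theorem hasCompactSupport_halfWaveSymbol [FiniteDimensional ℝ V]
    (hχ : ∀ ξ, χ ξ ≠ 0 → ‖ξ‖ ∈ Icc (1 / 4 : ℝ) 4) (hN : 0 < N)
    (s : ℝ) : HasCompactSupport (halfWaveSymbol χ s N) :=
  .intro (isCompact_closedBall 0 (4 * N)) fun ξ hξ =>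
    halfWaveSymbol_eq_zero hχ hN fun h => hξ (by simpa using h.2)

theorem contDiff_halfWaveSymbol (hχ : ∀ ξ, χ ξ ≠ 0 → ‖ξ‖ ∈ Icc (1 / 4 : ℝ) 4) (hN : 0 < N)
    (s : ℝ) : ContDiff ℝ (⊤ : ℕ∞) (halfWaveSymbol χ s N) := by
  refine contDiff_iff_contDiffAt.mpr fun ξ => ?_
  rcases eq_or_ne ξ 0 with rfl | hξ
  · refine (contDiffAt_const (c := (0 : ℂ))).congr_of_eventuallyEq ?_
    filter_upwards [ball_mem_nhds (0 : V) (show 0 < N / 4 by positivity)] with η hη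
    refine halfWaveSymbol_eq_zero hχ hN fun h => ?_
    rw [mem_ball_zero_iff] at hη
    exact hη.not_ge h.1
  · have h1 : ContDiffAt ℝ (⊤ : ℕ∞) (fun ξ : V => ‖ξ‖) ξ := contDiffAt_norm ℝ hξ
    have h2 : ContDiff ℝ (⊤ : ℕ∞) χ := χ.smooth ⊤
    have h3 : ContDiffAt ℝ (⊤ : ℕ∞) (fun ξ : V => ((s * ‖ξ‖ : ℝ) : ℂ)) ξ :=
      Complex.ofRealCLM.contDiff.contDiffAt.comp ξ (contDiffAt_const.mul h1)
    exact (contDiffAt_const.mul h3).cexp.mul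
      (h2.comp (contDiff_const_smul _)).contDiffAt

theorem exists_norm_integral_halfWaveSymbol_le [FiniteDimensional ℝ V] [MeasurableSpace V]
    [BorelSpace V] (hn : 2 ≤ Module.finrank ℝ V)
    (hχ : ∀ ξ, χ ξ ≠ 0 → ‖ξ‖ ∈ Icc (1 / 4 : ℝ) 4) :
    ∃ C, 0 < C ∧ ∀ (s N : ℝ), 0 < N → ∀ x : V,
      ‖∫ ξ, Complex.exp (2 * Real.pi * Complex.I * ⟪x, ξ⟫) * halfWaveSymbol χ s N ξ‖ ≤
        C * N ^ Module.finrank ℝ V *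
          (1 + |s| * N) ^ (-(((Module.finrank ℝ V : ℝ) - 1) / 2)) := by
  obtain ⟨C, hC, h⟩ := exists_norm_integral_halfWave_le hn χ hχ
  refine ⟨C, hC, fun s N hN x => ?_⟩
  have e : ∫ ξ, Complex.exp (2 * Real.pi * Complex.I * ⟪x, ξ⟫) * halfWaveSymbol χ s N ξ =
      (N ^ Module.finrank ℝ V) • ∫ η, Complex.exp (2 * Real.pi * Complex.I *
        ((s * N) * ‖η‖ + ⟪N • x, η⟫ : ℝ)) * χ η := by
    rw [← abs_of_pos (pow_pos hN (Module.finrank ℝ V)), ← Measure.integral_comp_inv_smul]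
    refine integral_congr_ae (.of_forall fun ξ => ?_)
    simp only [halfWaveSymbol]
    rw [← mul_assoc, ← Complex.exp_add]
    congr 2
    rw [norm_smul, norm_inv, Real.norm_of_nonneg hN.le, inner_smul_left, inner_smul_right]
    have hN' : (N : ℂ) ≠ 0 := by exact_mod_cast hN.ne'
    simp only [conj_trivial]
    push_cast
    field_simp
    ring
  rw [e, norm_smul, Real.norm_of_nonneg (by positivity), mul_comm C, mul_assoc _ C]
  refine mul_le_mul_of_nonneg_left ?_ (pow_nonneg hN.le _)
  have := h (s * N) (N • x)
  rwa [abs_mul, abs_of_pos hN] at this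

end HalfWaveSymbol

theorem fourierMultiplierCLM_eq_fmulD {d : ℕ} {m : Ed d → ℂ} (hm : HasCompactSupport m)
    (hmd : ContDiff ℝ (⊤ : ℕ∞) m) (f : 𝓢(Ed d, ℂ)) :
    ⇑(fourierMultiplierCLM ℂ m f) = fmulD d m f := by
  ext x
  rw [fmulD, fourierMultiplierCLM_apply, fourierInv_coe]
  refine congrArg (fun h : Ed d → ℂ => 𝓕⁻ h x) (funext fun ξ => ?_)
  rw [smulLeftCLM_apply_apply (hm.hasTemperateGrowth hmd), fourier_coe, smul_eq_mul]

section LPBump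

variable {d : ℕ} {φ : Ed d → ℝ}

theorem hasCompactSupport_LPD_symbol (hφ : IsLPBumpD d φ) {a b : ℝ} (ha : 0 < a) (hb : 0 < b) :
    HasCompactSupport fun ξ => ((φ (a • ξ) - φ (b • ξ) : ℝ) : ℂ) := by
  refine .intro (isCompact_closedBall 0 (2 / a + 2 / b)) fun ξ hξ => ?_
  have hξ : 2 / a + 2 / b < ‖ξ‖ := by simpa using hξ
  have h1 : 2 / a ≤ ‖ξ‖ := by linarith [div_pos two_pos hb]
  have h2 : 2 / b ≤ ‖ξ‖ := by linarith [div_pos two_pos ha]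
  rw [div_le_iff₀' (by assumption)] at h1 h2
  rw [hφ.eq_zero _ (by rwa [norm_smul, Real.norm_of_nonneg ha.le]),
    hφ.eq_zero _ (by rwa [norm_smul, Real.norm_of_nonneg hb.le])]
  simp

theorem contDiff_LPD_symbol (hφ : IsLPBumpD d φ) (a b : ℝ) :
    ContDiff ℝ (⊤ : ℕ∞) fun ξ => ((φ (a • ξ) - φ (b • ξ) : ℝ) : ℂ) :=
  Complex.ofRealCLM.contDiff.comp
    ((hφ.smooth.comp (contDiff_const_smul a)).sub (hφ.smooth.comp (contDiff_const_smul b)))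

/-- A Littlewood–Paley cutoff that equals one wherever the given one is nonzero. -/
theorem exists_fattened_LPD_symbol (hφ : IsLPBumpD d φ) :
    ∃ χ : 𝓢(Ed d, ℂ), (∀ ξ, χ ξ ≠ 0 → ‖ξ‖ ∈ Icc (1 / 4 : ℝ) 4) ∧ (∀ ξ, ‖χ ξ‖ ≤ 1) ∧
      ∀ ξ, φ ξ - φ ((2 : ℝ) • ξ) ≠ 0 → χ ξ = 1 := by
  refine ⟨(hasCompactSupport_LPD_symbol hφ (a := 1 / 2) (b := 4) (by norm_num)
    (by norm_num)).toSchwartzMap (contDiff_LPD_symbol hφ _ _), fun ξ => ?_, fun ξ => ?_,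
    fun ξ => ?_⟩
  · change ((φ ((1 / 2 : ℝ) • ξ) - φ ((4 : ℝ) • ξ) : ℝ) : ℂ) ≠ 0 → _
    contrapose!
    intro h
    rw [mem_Icc, not_and_or, not_le, not_le] at h
    rcases h with h | h
    · rw [hφ.eq_one _ (by rw [norm_smul]; norm_num; linarith),
        hφ.eq_one _ (by rw [norm_smul]; norm_num; linarith)]
      simp
    · rw [hφ.eq_zero _ (by rw [norm_smul]; norm_num; linarith),
        hφ.eq_zero _ (by rw [norm_smul]; norm_num; linarith)]
      simp
  · change ‖((φ ((1 / 2 : ℝ) • ξ) - φ ((4 : ℝ) • ξ) : ℝ) : ℂ)‖ ≤ 1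
    have h1 := hφ.mem_Icc ((1 / 2 : ℝ) • ξ)
    have h2 := hφ.mem_Icc ((4 : ℝ) • ξ)
    rw [Complex.norm_real, Real.norm_eq_abs, abs_le]
    exact ⟨by linarith [h1.1, h2.2], by linarith [h1.2, h2.1]⟩
  · intro h
    change ((φ ((1 / 2 : ℝ) • ξ) - φ ((4 : ℝ) • ξ) : ℝ) : ℂ) = 1
    have h1 : ‖ξ‖ ≤ 2 := by
      by_contra! h1
      refine h ?_
      rw [hφ.eq_zero _ h1.le, hφ.eq_zero _ (by rw [norm_smul]; norm_num; linarith), sub_zero]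
    have h2 : 1 / 2 ≤ ‖ξ‖ := by
      by_contra! h2
      refine h ?_
      rw [hφ.eq_one _ (by linarith), hφ.eq_one _ (by rw [norm_smul]; norm_num; linarith), sub_self]
    rw [hφ.eq_one _ (by rw [norm_smul]; norm_num; linarith),
      hφ.eq_zero _ (by rw [norm_smul]; norm_num; linarith)]
    simp

theorem halfWaveD_LPD_eq (hφ : IsLPBumpD d φ) {χ : 𝓢(Ed d, ℂ)}
    (hχ : ∀ ξ, χ ξ ≠ 0 → ‖ξ‖ ∈ Icc (1 / 4 : ℝ) 4)
    (hχ1 : ∀ ξ, φ ξ - φ ((2 : ℝ) • ξ) ≠ 0 → χ ξ = 1) {N : ℝ} (hN : 0 < N) (σ t : ℝ)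
    {f g : 𝓢(Ed d, ℂ)} (hg : ⇑g = LPD d φ N f) :
    halfWaveD d σ t (LPD d φ N f) =
      fourierMultiplierCLM ℂ (halfWaveSymbol χ (σ * t) N) g := by
  rw [fourierMultiplierCLM_eq_fmulD (hasCompactSupport_halfWaveSymbol hχ hN _)
    (contDiff_halfWaveSymbol hχ hN _), halfWaveD, fmulD, fmulD, ← hg]
  congr 1
  ext ξ
  have h𝓕 : 𝓕 ⇑g ξ = ((φ (N⁻¹ • ξ) - φ ((2 / N) • ξ) : ℝ) : ℂ) * 𝓕 ⇑f ξ := by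
    have hm := hasCompactSupport_LPD_symbol hφ (inv_pos.mpr hN) (div_pos two_pos hN)
    have hmd := contDiff_LPD_symbol hφ N⁻¹ (2 / N)
    have : g = fourierMultiplierCLM ℂ
        (fun ξ => ((φ (N⁻¹ • ξ) - φ ((2 / N) • ξ) : ℝ) : ℂ)) f := by
      refine DFunLike.coe_injective ?_
      rw [hg, fourierMultiplierCLM_eq_fmulD hm hmd]
      rfl
    rw [this, ← fourier_coe, fourierMultiplierCLM_apply, FourierTransform.fourier_fourierInv_eq,
      smulLeftCLM_apply_apply (hm.hasTemperateGrowth hmd), fourier_coe, smul_eq_mul]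
  rw [h𝓕]
  by_cases h : φ (N⁻¹ • ξ) - φ ((2 / N) • ξ) = 0
  · simp [h]
  · rw [halfWaveSymbol, hχ1 _ (by rwa [smul_smul, ← div_eq_mul_inv]), mul_one]
    congr 2
    push_cast
    ring

end LPBump

/-- **Frequency-localized dispersive estimate for the half wave.** -/
theorem halfWave_dispersive_localized (d : ℕ) (hd : 2 ≤ d)
    (p : ℝ≥0∞) (hp : 2 ≤ p) (φ : Ed d → ℝ) (hφ : IsLPBumpD d φ) :
    ∃ C : ℝ≥0, ∀ (σ : ℝ), (σ = 1 ∨ σ = -1) →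
      ∀ (f : 𝓢(Ed d, ℂ)) (t : ℝ) (n : ℤ),
        eLpNorm (halfWaveD d σ t (LPD d φ ((2:ℝ) ^ n) (⇑f))) p volume ≤
          (C : ℝ≥0∞) *
            ENNReal.ofReal
              (((2:ℝ) ^ n) ^ ((d:ℝ) * (1 - 2 * (p⁻¹).toReal)) *
                (1 + |t| * (2:ℝ) ^ n) ^ (-(((d:ℝ) - 1) * (1/2 - (p⁻¹).toReal)))) *
            eLpNorm (LPD d φ ((2:ℝ) ^ n) (⇑f)) (1 - 1/p)⁻¹ volume := by
  obtain ⟨χ, hχ, hχ1, hχφ⟩ := exists_fattened_LPD_symbol hφ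
  obtain ⟨C, hC, hker⟩ := exists_norm_integral_halfWaveSymbol_le (by simpa using hd) hχ
  obtain ⟨c, hc, hinterp⟩ := exists_eLpNorm_le_of_endpoints (V := Ed d) p hp
  rw [finrank_euclideanSpace_fin] at hker
  refine ⟨(c * C ^ (1 - 2 * (p⁻¹).toReal)).toNNReal, fun σ hσ f t n => ?_⟩
  have hσ1 : |σ| = 1 := by rcases hσ with rfl | rfl <;> simp
  set N : ℝ := 2 ^ n
  have hN : 0 < N := by positivity
  have hm := hasCompactSupport_halfWaveSymbol hχ hN (σ * t)
  have hmd := contDiff_halfWaveSymbol hχ hN (σ * t)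
  set A : ℝ := C * N ^ d * (1 + |t| * N) ^ (-(((d : ℝ) - 1) / 2)) with hA
  have hT := hinterp (fourierMultiplierCLM ℂ (halfWaveSymbol χ (σ * t) N)).toLinearMap A
    (by positivity)
    (norm_fourierMultiplierCLM_apply_le hm hmd fun x => by
      have := hker (σ * t) N hN x
      rwa [abs_mul, hσ1, one_mul] at this)
    (integral_norm_sq_fourierMultiplierCLM_le hm hmd fun ξ => by
      rw [norm_halfWaveSymbol]; exact hχ1 _)
  have hg : ⇑(fourierMultiplierCLM ℂ
      (fun ξ => ((φ (N⁻¹ • ξ) - φ ((2 / N) • ξ) : ℝ) : ℂ)) f) = LPD d φ N f :=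
    fourierMultiplierCLM_eq_fmulD
      (hasCompactSupport_LPD_symbol hφ (inv_pos.mpr hN) (div_pos two_pos hN))
      (contDiff_LPD_symbol hφ _ _) f
  rw [halfWaveD_LPD_eq hφ hχ hχφ hN σ t hg, ← hg]
  refine (hT _).trans (le_of_eq ?_)
  congr 1
  rw [ENNReal.ofNNReal_toNNReal, ← ENNReal.ofReal_mul (by positivity), hA,
    Real.mul_rpow (by positivity) (by positivity), Real.mul_rpow (by positivity) (by positivity),
    ← Real.rpow_natCast N d, ← Real.rpow_mul hN.le, ← Real.rpow_mul (by positivity),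
    show -(((d : ℝ) - 1) / 2) * (1 - 2 * (p⁻¹).toReal) =
      -(((d : ℝ) - 1) * (1 / 2 - (p⁻¹).toReal)) by ring]
  simp only [mul_assoc]

end
end
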